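/- arXiv:1309.4588 — 8 statements merged into one kernel-verified Lean document; each statement's English description precedes it below -/
import Mathlib

section
/- The measure γ_m is invariant under τ_m: for every Borel set A ⊆ [0,1], γ_m(τ_m⁻¹(A)) = γ_m(A); in particular τ_m is a measure-preserving transformation of ([0,1], γ_m). -/
open MeasureTheory Set

/-- The Chan transformation `τ_m : [0,1] → [0,1]`: `τ_m(0) = 0` and, for
`x ∈ (m^{-(i+1)}, m^{-i}]` (equivalently `i = ⌊-log_m x⌋`),
`τ_m(x) = (1/(m-1)) (1/(mⁱ x) - 1)`. -/
noncomputable def chanTau (m : ℕ) (x : ℝ) : ℝ :=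
  if x = 0 then 0
  else (1 / ((m : ℝ) - 1)) * (1 / ((m : ℝ) ^ ⌊-Real.logb m x⌋ * x) - 1)

/-- The normalizing constant `k_m = (m-1)^2 / log(m^2/(2m-1))`. -/
noncomputable def chanK (m : ℕ) : ℝ :=
  ((m : ℝ) - 1) ^ 2 / Real.log ((m : ℝ) ^ 2 / (2 * (m : ℝ) - 1))

/-- The density `ρ_m(x) = k_m / (((m-1)x+1)((m-1)x+m))`. -/
noncomputable def chanRho (m : ℕ) (x : ℝ) : ℝ :=
  chanK m / ((((m : ℝ) - 1) * x + 1) * (((m : ℝ) - 1) * x + (m : ℝ)))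

/-- The measure `γ_m` on `[0,1]` with density `ρ_m` w.r.t. Lebesgue measure. -/
noncomputable def chanGamma (m : ℕ) : Measure ℝ :=
  (volume.restrict (Set.Icc (0 : ℝ) 1)).withDensity fun x => ENNReal.ofReal (chanRho m x)

/-- The inverse branch of `chanTau m` on `(m^{-(i+1)}, m^{-i}]`. -/
noncomputable def chanBranch (m i : ℕ) (y : ℝ) : ℝ :=
  ((m : ℝ) ^ i * (((m : ℝ) - 1) * y + 1))⁻¹

lemma measurable_chanTau (m : ℕ) : Measurable (chanTau m) := by
  have hfloor : Measurable fun x : ℝ => ⌊-Real.logb m x⌋ := by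
    unfold Real.logb
    fun_prop
  have hpow : Measurable fun x : ℝ => (m : ℝ) ^ ⌊-Real.logb m x⌋ :=
    (measurable_of_countable fun k : ℤ => (m : ℝ) ^ k).comp hfloor
  unfold chanTau
  refine Measurable.ite (measurableSet_singleton 0) measurable_const ?_
  fun_prop

lemma measurable_chanRho (m : ℕ) : Measurable (chanRho m) := by
  unfold chanRho
  fun_prop

section Branch

variable {m : ℕ}

lemma chanBranch_pos (hm : 2 ≤ m) (i : ℕ) {y : ℝ} (hy : 0 ≤ y) : 0 < chanBranch m i y := by
  have hm' : (2 : ℝ) ≤ m := by exact_mod_cast hm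
  have : 0 ≤ ((m : ℝ) - 1) * y := mul_nonneg (by linarith) hy
  unfold chanBranch
  positivity

lemma floor_neg_logb_chanBranch (hm : 2 ≤ m) (i : ℕ) {y : ℝ} (hy : y ∈ Ico (0 : ℝ) 1) :
    ⌊-Real.logb m (chanBranch m i y)⌋ = i := by
  have hm' : (2 : ℝ) ≤ m := by exact_mod_cast hm
  have hy0 : 0 ≤ ((m : ℝ) - 1) * y := mul_nonneg (by linarith) hy.1
  have hy1 : ((m : ℝ) - 1) * y < m - 1 := by nlinarith [hy.2]
  have hlog : -Real.logb m (chanBranch m i y) = i + Real.logb m (((m : ℝ) - 1) * y + 1) := by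
    unfold chanBranch
    rw [Real.logb_inv, neg_neg, Real.logb_mul (by positivity) (by positivity), Real.logb_pow,
      Real.logb_self_eq_one (by linarith), mul_one]
  have h0 : 0 ≤ Real.logb m (((m : ℝ) - 1) * y + 1) :=
    Real.logb_nonneg (by linarith) (by linarith)
  have h1 : Real.logb m (((m : ℝ) - 1) * y + 1) < 1 := by
    rw [Real.logb_lt_iff_lt_rpow (by linarith) (by linarith), Real.rpow_one]
    linarith
  rw [hlog, Int.floor_eq_iff]
  push_cast
  constructor <;> linarith

lemma chanTau_chanBranch (hm : 2 ≤ m) (i : ℕ) {y : ℝ} (hy : y ∈ Ico (0 : ℝ) 1) :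
    chanTau m (chanBranch m i y) = y := by
  have hm' : (2 : ℝ) ≤ m := by exact_mod_cast hm
  have hm1 : (m : ℝ) - 1 ≠ 0 := by linarith
  have hy0 : 0 ≤ ((m : ℝ) - 1) * y := mul_nonneg (by linarith) hy.1
  have hu : ((m : ℝ) - 1) * y + 1 ≠ 0 := by positivity
  rw [chanTau, if_neg (chanBranch_pos hm i hy.1).ne', floor_neg_logb_chanBranch hm i hy,
    zpow_natCast, chanBranch]
  field_simp
  ring

lemma chanBranch_mem_Ioc (hm : 2 ≤ m) (i : ℕ) {y : ℝ} (hy : 0 ≤ y) :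
    chanBranch m i y ∈ Ioc (0 : ℝ) 1 := by
  have hm' : (2 : ℝ) ≤ m := by exact_mod_cast hm
  have hy0 : 0 ≤ ((m : ℝ) - 1) * y := mul_nonneg (by linarith) hy
  refine ⟨chanBranch_pos hm i hy, inv_le_one_of_one_le₀ ?_⟩
  exact one_le_mul_of_one_le_of_one_le (one_le_pow₀ (by linarith)) (by linarith)

lemma exists_chanBranch_chanTau (hm : 2 ≤ m) {x : ℝ} (hx : x ∈ Ioc (0 : ℝ) 1) :
    chanTau m x ∈ Ico (0 : ℝ) 1 ∧ ∃ i, chanBranch m i (chanTau m x) = x := by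
  have hm' : (2 : ℝ) ≤ m := by exact_mod_cast hm
  have hm1 : 0 < (m : ℝ) - 1 := by linarith
  have hx0 := hx.1
  obtain ⟨i, hi⟩ : ∃ i : ℕ, ⌊-Real.logb m x⌋ = i := by
    refine Int.eq_ofNat_of_zero_le (Int.floor_nonneg.2 ?_)
    have := Real.logb_nonpos (b := m) (by linarith) hx0.le hx.2
    linarith
  have hle := (Int.floor_eq_iff.1 hi).1
  have hlt := (Int.floor_eq_iff.1 hi).2
  push_cast at hle hlt
  have hp : 0 < (m : ℝ) ^ i := by positivity
  have hupper : (m : ℝ) ^ i * x ≤ 1 := by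
    have h := (Real.logb_le_iff_le_rpow (b := m) (by linarith) hx0).1
      (show Real.logb m x ≤ -(i : ℝ) by linarith)
    rw [Real.rpow_neg (by linarith), Real.rpow_natCast] at h
    calc (m : ℝ) ^ i * x ≤ (m : ℝ) ^ i * ((m : ℝ) ^ i)⁻¹ := by gcongr
      _ = 1 := mul_inv_cancel₀ hp.ne'
  have hlower : 1 < m * ((m : ℝ) ^ i * x) := by
    have h := (Real.lt_logb_iff_rpow_lt (b := m) (by linarith) hx0).1
      (show -((i + 1 : ℕ) : ℝ) < Real.logb m x by push_cast; linarith)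
    rw [Real.rpow_neg (by linarith), Real.rpow_natCast, inv_lt_iff_one_lt_mul₀ (by positivity)] at h
    rw [pow_succ] at h
    linarith
  have hq : 0 < (m : ℝ) ^ i * x := by positivity
  have hτ : chanTau m x = (1 / ((m : ℝ) - 1)) * (1 / ((m : ℝ) ^ i * x) - 1) := by
    rw [chanTau, if_neg hx0.ne', hi, zpow_natCast]
  have hu : ((m : ℝ) - 1) * chanTau m x + 1 = 1 / ((m : ℝ) ^ i * x) := by
    rw [hτ]
    field_simp
    ring
  have h1 : 1 ≤ 1 / ((m : ℝ) ^ i * x) := by rwa [le_div_iff₀ hq, one_mul]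
  have h2 : 1 / ((m : ℝ) ^ i * x) < m := by rwa [div_lt_iff₀ hq]
  refine ⟨⟨?_, ?_⟩, i, ?_⟩
  · by_contra! h
    nlinarith
  · by_contra! h
    nlinarith
  · rw [chanBranch, hu]
    field_simp

lemma Ioc_inter_preimage_chanTau (hm : 2 ≤ m) (A : Set ℝ) :
    Ioc (0 : ℝ) 1 ∩ chanTau m ⁻¹' A = ⋃ i, chanBranch m i '' (Ico (0 : ℝ) 1 ∩ A) := by
  ext x
  simp only [mem_inter_iff, mem_preimage, mem_iUnion, mem_image]
  constructor
  · rintro ⟨hx, hA⟩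
    obtain ⟨hτ, i, hi⟩ := exists_chanBranch_chanTau hm hx
    exact ⟨i, _, ⟨hτ, hA⟩, hi⟩
  · rintro ⟨i, y, ⟨hy, hA⟩, rfl⟩
    exact ⟨chanBranch_mem_Ioc hm i hy.1, by rwa [chanTau_chanBranch hm i hy]⟩

lemma injOn_chanBranch (hm : 2 ≤ m) (i : ℕ) : InjOn (chanBranch m i) (Ico (0 : ℝ) 1) :=
  LeftInvOn.injOn fun _ hy => chanTau_chanBranch hm i hy

lemma pairwise_disjoint_image_chanBranch (hm : 2 ≤ m) (A : Set ℝ) :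
    Pairwise (Function.onFun Disjoint fun i => chanBranch m i '' (Ico (0 : ℝ) 1 ∩ A)) := by
  intro i j hij
  refine Set.disjoint_left.2 ?_
  rintro _ ⟨y, hy, rfl⟩ ⟨z, hz, hzy⟩
  have h := floor_neg_logb_chanBranch hm j hz.1
  rw [hzy, floor_neg_logb_chanBranch hm i hy.1] at h
  exact hij (by exact_mod_cast h)

lemma hasDerivAt_chanBranch (hm : 2 ≤ m) (i : ℕ) {y : ℝ} (hy : 0 ≤ y) :
    HasDerivAt (chanBranch m i)
      (-((m : ℝ) ^ i * ((m : ℝ) - 1)) / ((m : ℝ) ^ i * (((m : ℝ) - 1) * y + 1)) ^ 2) y := by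
  have hm' : (2 : ℝ) ≤ m := by exact_mod_cast hm
  have hy0 : 0 ≤ ((m : ℝ) - 1) * y := mul_nonneg (by linarith) hy
  have h : HasDerivAt (fun y : ℝ => (m : ℝ) ^ i * (((m : ℝ) - 1) * y + 1))
      ((m : ℝ) ^ i * ((m : ℝ) - 1)) y := by
    simpa using (((hasDerivAt_id y).const_mul ((m : ℝ) - 1)).add_const 1).const_mul ((m : ℝ) ^ i)
  exact h.inv (by positivity)

lemma chanK_nonneg (hm : 2 ≤ m) : 0 ≤ chanK m := by
  have hm' : (2 : ℝ) ≤ m := by exact_mod_cast hm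
  refine div_nonneg (sq_nonneg _) (Real.log_nonneg ?_)
  rw [le_div_iff₀ (by linarith)]
  nlinarith [sq_nonneg ((m : ℝ) - 1)]

lemma chanRho_nonneg (hm : 2 ≤ m) {y : ℝ} (hy : 0 ≤ y) : 0 ≤ chanRho m y := by
  have hm' : (2 : ℝ) ≤ m := by exact_mod_cast hm
  have hy0 : 0 ≤ ((m : ℝ) - 1) * y := mul_nonneg (by linarith) hy
  have := chanK_nonneg hm
  unfold chanRho
  positivity

/-- The transfer operator of `chanTau m` fixes the density; the series telescopes. -/
lemma hasSum_abs_deriv_chanBranch_mul_chanRho (hm : 2 ≤ m) {y : ℝ} (hy : 0 ≤ y) :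
    HasSum (fun i : ℕ =>
      |-((m : ℝ) ^ i * ((m : ℝ) - 1)) / ((m : ℝ) ^ i * (((m : ℝ) - 1) * y + 1)) ^ 2| *
        chanRho m (chanBranch m i y)) (chanRho m y) := by
  have hm' : (2 : ℝ) ≤ m := by exact_mod_cast hm
  have hm1 : 0 < (m : ℝ) - 1 := by linarith
  have hy0 : 0 ≤ ((m : ℝ) - 1) * y := mul_nonneg hm1.le hy
  obtain ⟨u, hu⟩ : ∃ u, u = ((m : ℝ) - 1) * y + 1 := ⟨_, rfl⟩
  have hu0 : 0 < u := by rw [hu]; positivity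
  let F : ℕ → ℝ := fun i => chanK m / (m - 1) * (u + (m - 1) * ((m : ℝ)⁻¹) ^ i)⁻¹
  have hterm : ∀ i : ℕ,
      |-((m : ℝ) ^ i * ((m : ℝ) - 1)) / ((m : ℝ) ^ i * (((m : ℝ) - 1) * y + 1)) ^ 2| *
        chanRho m (chanBranch m i y) = F (i + 1) - F i := by
    intro i
    have hp : 0 < (m : ℝ) ^ i := by positivity
    rw [neg_div, abs_neg, abs_of_nonneg (by positivity)]
    simp only [F, chanRho, chanBranch, ← hu, inv_pow, pow_succ]
    generalize (m : ℝ) ^ i = p at hp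
    have e1 : ((m : ℝ) - 1) * (p * u)⁻¹ + 1 = (m - 1 + p * u) / (p * u) := by field_simp
    have e2 : ((m : ℝ) - 1) * (p * u)⁻¹ + m = (m - 1 + m * (p * u)) / (p * u) := by field_simp
    have e3 : u + ((m : ℝ) - 1) * (p * m)⁻¹ = (m - 1 + m * (p * u)) / (p * m) := by
      field_simp
      ring
    have e4 : u + ((m : ℝ) - 1) * p⁻¹ = (m - 1 + p * u) / p := by
      field_simp
      ring
    rw [e1, e2, e3, e4]
    have h1 : (m : ℝ) - 1 + p * u ≠ 0 := by positivity
    have h2 : (m : ℝ) - 1 + m * (p * u) ≠ 0 := by positivity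
    field_simp
    ring
  have hlim : Filter.Tendsto F Filter.atTop (nhds (chanK m / (m - 1) * u⁻¹)) := by
    have h0 : Filter.Tendsto (fun i : ℕ => ((m : ℝ)⁻¹) ^ i) Filter.atTop (nhds 0) :=
      tendsto_pow_atTop_nhds_zero_of_lt_one (by positivity) (inv_lt_one_of_one_lt₀ (by linarith))
    have h1 : Filter.Tendsto (fun i : ℕ => u + (m - 1) * ((m : ℝ)⁻¹) ^ i) Filter.atTop (nhds u) := by
      simpa using (h0.const_mul ((m : ℝ) - 1)).const_add u
    exact (h1.inv₀ hu0.ne').const_mul _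
  have hval : chanRho m y = chanK m / (m - 1) * u⁻¹ - F 0 := by
    have e : ((m : ℝ) - 1) * y + m = u + (m - 1) := by rw [hu]; ring
    have : u + ((m : ℝ) - 1) ≠ 0 := by positivity
    simp only [F, chanRho, ← hu, e, pow_zero, mul_one]
    field_simp
    ring
  rw [hasSum_iff_tendsto_nat_of_nonneg
    fun i => mul_nonneg (abs_nonneg _) (chanRho_nonneg hm (chanBranch_pos hm i hy).le), hval]
  simp_rw [hterm, Finset.sum_range_sub]
  exact hlim.sub_const _

lemma chanGamma_apply (m : ℕ) {A : Set ℝ} (hA : MeasurableSet A) :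
    chanGamma m A = ∫⁻ x in Ioc (0 : ℝ) 1 ∩ A, ENNReal.ofReal (chanRho m x) := by
  rw [chanGamma, withDensity_apply _ hA, Measure.restrict_congr_set (Ioc_ae_eq_Icc (α := ℝ)).symm,
    Measure.restrict_restrict hA, inter_comm]

lemma chanGamma_preimage_chanTau (hm : 2 ≤ m) {A : Set ℝ} (hA : MeasurableSet A) :
    chanGamma m (chanTau m ⁻¹' A) = chanGamma m A := by
  have hS : MeasurableSet (Ico (0 : ℝ) 1 ∩ A) := measurableSet_Ico.inter hA
  have hderiv (i : ℕ) (y : ℝ) (hy : y ∈ Ico (0 : ℝ) 1 ∩ A) :=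
    (hasDerivAt_chanBranch hm i hy.1.1).hasDerivWithinAt (s := Ico (0 : ℝ) 1 ∩ A)
  have hinj (i : ℕ) : InjOn (chanBranch m i) (Ico (0 : ℝ) 1 ∩ A) :=
    (injOn_chanBranch hm i).mono inter_subset_left
  have hρ := measurable_chanRho m
  rw [chanGamma_apply m (measurable_chanTau m hA), chanGamma_apply m hA,
    Ioc_inter_preimage_chanTau hm, lintegral_iUnion
      (fun i => measurable_image_of_fderivWithin hS (fun y hy => (hderiv i y hy).hasFDerivWithinAt)
        (hinj i))
      (pairwise_disjoint_image_chanBranch hm A)]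
  simp_rw [fun i => lintegral_image_eq_lintegral_abs_deriv_mul hS (hderiv i) (hinj i)
    fun x => ENNReal.ofReal (chanRho m x)]
  have hbranch (i : ℕ) : Measurable (chanBranch m i) := by
    unfold chanBranch
    fun_prop
  rw [← lintegral_tsum fun i => by fun_prop]
  rw [setLIntegral_congr ((Ioo_ae_eq_Ioc (α := ℝ)).symm.trans Ioo_ae_eq_Ico |>.inter
    (Filter.EventuallyEq.refl _ A))]
  refine setLIntegral_congr_fun hS fun y hy => ?_
  have hsum := hasSum_abs_deriv_chanBranch_mul_chanRho hm hy.1.1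
  simp_rw [← ENNReal.ofReal_mul (abs_nonneg _)]
  rw [← hsum.tsum_eq, ENNReal.ofReal_tsum_of_nonneg _ hsum.summable]
  exact fun i => mul_nonneg (abs_nonneg _) (chanRho_nonneg hm (chanBranch_pos hm i hy.1.1).le)

end Branch

/-- `γ_m` is invariant under `τ_m`, i.e. `γ_m(τ_m⁻¹(A)) = γ_m(A)` for every
Borel set `A`; in particular `τ_m` is measure preserving for `γ_m`. -/
theorem chanTau_measurePreserving (m : ℕ) (hm : 2 ≤ m) :
    (∀ A : Set ℝ, MeasurableSet A → chanGamma m (chanTau m ⁻¹' A) = chanGamma m A) ∧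
      MeasurePreserving (chanTau m) (chanGamma m) (chanGamma m) := by
  refine ⟨fun A hA => chanGamma_preimage_chanTau hm hA, measurable_chanTau m, ?_⟩
  ext A hA
  rw [Measure.map_apply (measurable_chanTau m) hA, chanGamma_preimage_chanTau hm hA]
end

section
/- For every y ∈ [0,1], the preimage of [0,y] under τ_m is τ_m⁻¹([0,y]) = {0} ∪ ⋃_{i∈ℕ} [ m^{−i}/(1+(m−1)y), m^{−i} ]. -/
open MeasureTheory Set

theorem chanTau_eq_of_mem_Ioc {m : ℕ} (hm : 2 ≤ m) {x : ℝ} {i : ℤ}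
    (hx : x ∈ Set.Ioc ((m : ℝ) ^ (-(i + 1))) ((m : ℝ) ^ (-i))) :
    chanTau m x = (1 / ((m : ℝ) - 1)) * (1 / ((m : ℝ) ^ i * x) - 1) := by
  have hm1 : (1 : ℝ) < m := by exact_mod_cast hm
  have hm0 : (0 : ℝ) < m := by linarith
  have hx0 : 0 < x := (zpow_pos hm0 _).trans hx.1
  have hlog : ⌊-Real.logb m x⌋ = i := by
    rw [← Real.logb_inv, Int.floor_eq_iff]
    have h1 : (m : ℝ) ^ i ≤ x⁻¹ := by
      rw [le_inv_comm₀ (zpow_pos hm0 _) hx0, ← zpow_neg]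
      exact hx.2
    have h2 : x⁻¹ < (m : ℝ) ^ (i + 1) := by
      rw [inv_lt_comm₀ hx0 (zpow_pos hm0 _), ← zpow_neg]
      exact hx.1
    constructor
    · rw [Real.le_logb_iff_rpow_le hm1 (inv_pos.2 hx0), Real.rpow_intCast]
      exact h1
    · rw [Real.logb_lt_iff_lt_rpow hm1 (inv_pos.2 hx0)]
      exact_mod_cast h2
  rw [chanTau, if_neg hx0.ne', hlog]

theorem chanTau_zpow_neg {m : ℕ} (hm : 2 ≤ m) (i : ℤ) : chanTau m ((m : ℝ) ^ (-i)) = 0 := by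
  have hm1 : (1 : ℝ) < m := by exact_mod_cast hm
  have hm0 : (m : ℝ) ≠ 0 := by positivity
  rw [chanTau_eq_of_mem_Ioc hm ⟨zpow_lt_zpow_right₀ hm1 (by lia), le_rfl⟩, ← zpow_add₀ hm0]
  simp

/-- On the branch indexed by `i`, the condition `τ_m(x) ∈ [0, y]` bounds `x` below. -/
theorem chanTau_mem_Icc_iff {m : ℕ} (hm : 2 ≤ m) {x y : ℝ} {i : ℤ} (hy : 0 ≤ y)
    (hx : x ∈ Set.Ioc ((m : ℝ) ^ (-(i + 1))) ((m : ℝ) ^ (-i))) :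
    chanTau m x ∈ Set.Icc 0 y ↔ (m : ℝ) ^ (-i) / (1 + ((m : ℝ) - 1) * y) ≤ x := by
  have hm1 : (0 : ℝ) < m - 1 := by
    have : (1 : ℝ) < m := by exact_mod_cast hm
    linarith
  have hm0 : (0 : ℝ) < m := by linarith
  have hx0 : 0 < x := (zpow_pos hm0 _).trans hx.1
  have hp : 0 < (m : ℝ) ^ i := zpow_pos hm0 i
  have hd : 0 < 1 + ((m : ℝ) - 1) * y := by positivity
  have hle : (m : ℝ) ^ i * x ≤ 1 := by
    have := hx.2
    rwa [zpow_neg, ← one_div, le_div_iff₀' hp] at this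
  have hnonneg : 0 ≤ chanTau m x := by
    rw [chanTau_eq_of_mem_Ioc hm hx]
    have : 1 ≤ 1 / ((m : ℝ) ^ i * x) := (one_le_div (by positivity)).2 hle
    exact mul_nonneg (by positivity) (by linarith)
  rw [Set.mem_Icc, and_iff_right hnonneg, chanTau_eq_of_mem_Ioc hm hx, one_div_mul_eq_div,
    div_le_iff₀ hm1, sub_le_iff_le_add, div_le_iff₀ (by positivity), div_le_iff₀ hd, zpow_neg,
    inv_le_iff_one_le_mul₀ hp]
  ring_nf

/-- for every `y ∈ [0,1]`, the preimage of `[0,y]` under `τ_m` (as a map of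
`[0,1]`) is `{0} ∪ ⋃_{i∈ℕ} [ m⁻ⁱ/(1+(m-1)y), m⁻ⁱ ]`. -/
theorem chanTau_preimage_Icc (m : ℕ) (hm : 2 ≤ m) :
    ∀ y ∈ Set.Icc (0 : ℝ) 1,
      {x ∈ Set.Icc (0 : ℝ) 1 | chanTau m x ∈ Set.Icc 0 y} =
        {0} ∪ ⋃ i : ℕ,
          Set.Icc ((m : ℝ) ^ (-(i : ℤ)) / (1 + ((m : ℝ) - 1) * y)) ((m : ℝ) ^ (-(i : ℤ))) := by
  rintro y ⟨hy0, hy1⟩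
  have hm1 : (1 : ℝ) < m := by exact_mod_cast hm
  have hm0 : (0 : ℝ) < m := by linarith
  ext x
  simp only [Set.mem_ofPred_eq, Set.mem_union, Set.mem_singleton_iff, Set.mem_iUnion]
  constructor
  · rintro ⟨⟨hx0, hx1⟩, hxy⟩
    rcases hx0.eq_or_lt with rfl | hx0
    · exact Or.inl rfl
    obtain ⟨n, hn1, hn2⟩ := exists_mem_Ico_zpow (inv_pos.2 hx0) hm1
    have hx : x ∈ Set.Ioc ((m : ℝ) ^ (-(n + 1))) ((m : ℝ) ^ (-n)) := by
      rw [zpow_neg, zpow_neg]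
      exact ⟨(inv_lt_comm₀ hx0 (zpow_pos hm0 _)).1 hn2,
        (le_inv_comm₀ (zpow_pos hm0 _) hx0).1 hn1⟩
    have hn : 0 ≤ n := by
      have : (m : ℝ) ^ (0 : ℤ) < (m : ℝ) ^ (n + 1) := by
        rw [zpow_zero]
        exact ((one_le_inv₀ hx0).2 hx1).trans_lt hn2
      exact Int.lt_add_one_iff.1 ((zpow_lt_zpow_iff_right₀ hm1).1 this)
    lift n to ℕ using hn
    exact Or.inr ⟨n, (chanTau_mem_Icc_iff hm hy0 hx).1 hxy, hx.2⟩
  · rintro (rfl | ⟨i, hx⟩)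
    · simp [chanTau, hy0]
    have hle : (m : ℝ) ^ (-(i + 1 : ℤ)) ≤ x := by
      refine le_trans ?_ hx.1
      have hd : 0 < 1 + ((m : ℝ) - 1) * y := by nlinarith
      rw [neg_add, zpow_add₀ hm0.ne', zpow_neg_one, ← div_eq_mul_inv]
      exact div_le_div_of_nonneg_left (zpow_nonneg hm0.le _) hd (by nlinarith)
    have hx0 : 0 < x := (zpow_pos hm0 _).trans_le hle
    refine ⟨⟨hx0.le, hx.2.trans (zpow_le_one_of_nonpos₀ hm1.le (by lia))⟩, ?_⟩
    rcases hle.eq_or_lt with rfl | hlt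
    · rw [chanTau_zpow_neg hm]
      exact ⟨le_rfl, hy0⟩
    · exact (chanTau_mem_Icc_iff hm hy0 ⟨hlt, hx.2⟩).2 hx.1
end

section
/- The density ρ_m is a fixed point of the transfer operator of τ_m: for every x ∈ [0,1], Σ_{i=0}^{∞} ( (m−1)·m^{−i}/((m−1)x+1)² ) · ρ_m( m^{−i}/((m−1)x+1) ) = ρ_m(x), where ρ_m(x) = k_m/(((m−1)x+1)·((m−1)x+m)). -/
open MeasureTheory Set

/-- Telescoping series of a monotone convergent real sequence. -/
theorem hasSum_sub_of_monotone_of_tendsto {g : ℕ → ℝ} {l : ℝ} (hg : Monotone g)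
    (hl : Filter.Tendsto g Filter.atTop (nhds l)) :
    HasSum (fun i => g (i + 1) - g i) (l - g 0) := by
  rw [hasSum_iff_tendsto_nat_of_nonneg fun i => sub_nonneg.2 (hg i.le_succ)]
  simpa only [Finset.sum_range_sub] using hl.sub_const (g 0)

/-- Each term of the transfer operator applied to `ρ_m` is a telescoping difference. -/
theorem transfer_term_eq_sub (m : ℕ) (hm : 2 ≤ m) {x : ℝ} (hx : 0 ≤ x) (i : ℕ) :
    (((m : ℝ) - 1) * ((m : ℝ)⁻¹) ^ i / (((m : ℝ) - 1) * x + 1) ^ 2) *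
        chanRho m (((m : ℝ)⁻¹) ^ i / (((m : ℝ) - 1) * x + 1)) =
      chanK m / ((m : ℝ) - 1) *
        ((((m : ℝ) - 1) * ((m : ℝ)⁻¹) ^ (i + 1) + (((m : ℝ) - 1) * x + 1))⁻¹ -
          (((m : ℝ) - 1) * ((m : ℝ)⁻¹) ^ i + (((m : ℝ) - 1) * x + 1))⁻¹) := by
  have hm' : (2 : ℝ) ≤ m := by exact_mod_cast hm
  obtain ⟨a, ha⟩ : ∃ a : ℝ, a = m - 1 := ⟨_, rfl⟩
  have hma : (m : ℝ) = a + 1 := by linarith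
  have ha0 : 0 < a := by linarith
  have hq : 0 < ((m : ℝ)⁻¹) ^ i := by positivity
  have ht : 0 < a * x + 1 := by positivity
  rw [chanRho, pow_succ _ i, ← ha]
  generalize ((m : ℝ)⁻¹) ^ i = q at *
  generalize a * x + 1 = t at *
  generalize chanK m = k
  rw [hma]
  have h1 : a * (q / t) + 1 = (a * q + t) / t := by field_simp
  have h2 : a * (q / t) + (a + 1) = (a * q + (a + 1) * t) / t := by field_simp
  have h3 : a * (q * (a + 1)⁻¹) + t = (a * q + (a + 1) * t) / (a + 1) := by field_simp
  have h4 : a * q + t ≠ 0 := by positivity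
  have h5 : a * q + (a + 1) * t ≠ 0 := by positivity
  rw [h1, h2, h3]
  field_simp
  ring

/-- `ρ_m` is a fixed point of the transfer operator of `τ_m`:
`Σ_i ((m-1)m⁻ⁱ/((m-1)x+1)²) ρ_m(m⁻ⁱ/((m-1)x+1)) = ρ_m(x)` for all `x ∈ [0,1]`. -/
theorem chanRho_fixed_point (m : ℕ) (hm : 2 ≤ m) :
    ∀ x ∈ Set.Icc (0 : ℝ) 1,
      (∑' i : ℕ,
          (((m : ℝ) - 1) * ((m : ℝ)⁻¹) ^ i / (((m : ℝ) - 1) * x + 1) ^ 2) *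
            chanRho m (((m : ℝ)⁻¹) ^ i / (((m : ℝ) - 1) * x + 1))) = chanRho m x := by
  intro x hx
  have hm' : (2 : ℝ) ≤ m := by exact_mod_cast hm
  have ha : 0 < (m : ℝ) - 1 := by linarith
  have ht : 0 < ((m : ℝ) - 1) * x + 1 := by
    have := mul_nonneg ha.le hx.1
    linarith
  have hinv : (m : ℝ)⁻¹ < 1 := inv_lt_one_of_one_lt₀ (by linarith)
  have hmono : Monotone fun i : ℕ =>
      (((m : ℝ) - 1) * ((m : ℝ)⁻¹) ^ i + (((m : ℝ) - 1) * x + 1))⁻¹ := by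
    intro i j hij
    have hpow : ((m : ℝ)⁻¹) ^ j ≤ ((m : ℝ)⁻¹) ^ i :=
      pow_le_pow_of_le_one (by positivity) hinv.le hij
    dsimp only
    gcongr
  have hlim : Filter.Tendsto (fun i : ℕ =>
      (((m : ℝ) - 1) * ((m : ℝ)⁻¹) ^ i + (((m : ℝ) - 1) * x + 1))⁻¹) Filter.atTop
      (nhds (((m : ℝ) - 1) * 0 + (((m : ℝ) - 1) * x + 1))⁻¹) :=
    (((tendsto_pow_atTop_nhds_zero_of_lt_one (by positivity) hinv).const_mul _).add_const
      _).inv₀ (by simpa using ht.ne')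
  have hsum := (hasSum_sub_of_monotone_of_tendsto hmono hlim).mul_left (chanK m / ((m : ℝ) - 1))
  simp only [transfer_term_eq_sub m hm hx.1]
  rw [hsum.tsum_eq, chanRho]
  have h1 : ((m : ℝ) - 1) * x + m ≠ 0 := ne_of_gt (by linarith)
  have h2 : ((m : ℝ) - 1) * ((m : ℝ)⁻¹) ^ 0 + (((m : ℝ) - 1) * x + 1) =
      ((m : ℝ) - 1) * x + m := by ring
  rw [h2, mul_zero, zero_add]
  field_simp
  ring
end

section
/- For every i ∈ ℕ, the function x ↦ P_mⁱ((m−1)x) is differentiable on [0,1] with derivative (d/dx) P_mⁱ((m−1)x) = (m−1)·( β_m^{i+1}(x) − β_mⁱ(x) ), where β_mⁱ(x) = (m−1)δ_i / ((m−1)x+(m−1)αⁱ+1)², α = 1/m and δ_i = αⁱ − α^{2i}. -/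
open Set

/-- `P_mⁱ(t) = (m-1)·m^{-(i+1)}·(t+1)(t+m) / ((t+(m-1)m^{-i}+1)(t+(m-1)m^{-(i+1)}+1))`. -/
noncomputable def chanP (m : ℕ) (i : ℕ) (t : ℝ) : ℝ :=
  ((m : ℝ) - 1) * (m : ℝ) ^ (-(i : ℤ) - 1) * (t + 1) * (t + (m : ℝ)) /
    ((t + ((m : ℝ) - 1) * (m : ℝ) ^ (-(i : ℤ)) + 1) *
      (t + ((m : ℝ) - 1) * (m : ℝ) ^ (-(i : ℤ) - 1) + 1))

/-- `δ_i = αⁱ − α^{2i}` with `α = 1/m`. -/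
noncomputable def chanDelta (m : ℕ) (i : ℕ) : ℝ :=
  ((m : ℝ)⁻¹) ^ i - ((m : ℝ)⁻¹) ^ (2 * i)

/-- `β_mⁱ(x) = (m-1)δ_i / ((m-1)x+(m-1)αⁱ+1)²` with `α = 1/m`. -/
noncomputable def chanBeta (m : ℕ) (i : ℕ) (x : ℝ) : ℝ :=
  ((m : ℝ) - 1) * chanDelta m i /
    (((m : ℝ) - 1) * x + ((m : ℝ) - 1) * ((m : ℝ)⁻¹) ^ i + 1) ^ 2

theorem chanP_eq_partialFraction (m : ℕ) (hm : 2 ≤ m) (i : ℕ) {t : ℝ} (ht : 0 ≤ t) :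
    chanP m i t = ((m : ℝ) - 1) * ((m : ℝ)⁻¹) ^ (i + 1)
      + ((m : ℝ) - 1) * chanDelta m i / (t + ((m : ℝ) - 1) * ((m : ℝ)⁻¹) ^ i + 1)
      - ((m : ℝ) - 1) * chanDelta m (i + 1) /
        (t + ((m : ℝ) - 1) * ((m : ℝ)⁻¹) ^ (i + 1) + 1) := by
  have hm' : (2 : ℝ) ≤ m := by exact_mod_cast hm
  have hk : (0 : ℝ) ≤ (m : ℝ) - 1 := by linarith
  have hm0 : (m : ℝ) ≠ 0 := by positivity
  have hi : (m : ℝ) ^ (-(i : ℤ)) = ((m : ℝ)⁻¹) ^ i := by simp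
  have hi' : (m : ℝ) ^ (-(i : ℤ) - 1) = ((m : ℝ)⁻¹) ^ (i + 1) := by
    rw [zpow_sub_one₀ hm0, hi, pow_succ]
  have hab : ((m : ℝ)⁻¹) ^ i = m * ((m : ℝ)⁻¹) ^ (i + 1) := by
    rw [pow_succ', mul_inv_cancel_left₀ hm0]
  have hb : 0 ≤ ((m : ℝ)⁻¹) ^ (i + 1) := by positivity
  unfold chanP chanDelta
  rw [hi, hi', mul_comm 2 i, mul_comm 2 (i + 1), pow_mul, pow_mul, hab]
  generalize ((m : ℝ)⁻¹) ^ (i + 1) = b at hb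
  have h₁ : t + ((m : ℝ) - 1) * (m * b) + 1 ≠ 0 := by positivity
  have h₂ : t + ((m : ℝ) - 1) * b + 1 ≠ 0 := by positivity
  field_simp
  ring

/-- for every `i ∈ ℕ`, the function `x ↦ P_mⁱ((m-1)x)` is differentiable on
`[0,1]` with derivative `(m-1)(β_m^{i+1}(x) − β_mⁱ(x))`. -/
theorem chanP_hasDerivWithinAt (m : ℕ) (hm : 2 ≤ m) :
    ∀ i : ℕ, ∀ x ∈ Set.Icc (0 : ℝ) 1,
      HasDerivWithinAt (fun y => chanP m i (((m : ℝ) - 1) * y))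
        (((m : ℝ) - 1) * (chanBeta m (i + 1) x - chanBeta m i x))
        (Set.Icc (0 : ℝ) 1) x := by
  intro i x hx
  have hk : (0 : ℝ) ≤ (m : ℝ) - 1 := by
    have : (2 : ℝ) ≤ m := by exact_mod_cast hm
    linarith
  have hterm (j : ℕ) : HasDerivAt
      (fun y : ℝ => ((m : ℝ) - 1) * chanDelta m j /
        (((m : ℝ) - 1) * y + ((m : ℝ) - 1) * ((m : ℝ)⁻¹) ^ j + 1))
      (-(((m : ℝ) - 1) * chanBeta m j x)) x := by
    have hden : ((m : ℝ) - 1) * x + ((m : ℝ) - 1) * ((m : ℝ)⁻¹) ^ j + 1 ≠ 0 := by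
      have := mul_nonneg hk hx.1
      positivity
    have hlin := (((hasDerivAt_id x).const_mul ((m : ℝ) - 1)).add_const
      (((m : ℝ) - 1) * ((m : ℝ)⁻¹) ^ j)).add_const 1
    refine ((hasDerivAt_const x (((m : ℝ) - 1) * chanDelta m j)).fun_div hlin hden).congr_deriv ?_
    simp only [chanBeta, id]
    ring
  have hsum := (((hterm i).const_add (((m : ℝ) - 1) * ((m : ℝ)⁻¹) ^ (i + 1))).sub
    (hterm (i + 1))).hasDerivWithinAt (s := Set.Icc (0 : ℝ) 1)
  refine (hsum.congr_deriv (by ring)).congr_of_mem (fun y hy => ?_) hx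
  exact chanP_eq_partialFraction m hm i (mul_nonneg hk hy.1)
end

section
/- For every i ∈ ℕ, the function h_m(x) = αⁱ·P_mⁱ((m−1)x) / ((m−1)x+1)² is monotonically decreasing on [0,1]; consequently, for all x ∈ [0,1], αⁱ·P_mⁱ((m−1)x) / ((m−1)x+1)² ≤ (m−1)·α^{2i} / ((m−1)α^{i+1}+1)². -/
open Set

/-- After cancelling a factor `t + 1`, the weighted density splits into decreasing factors. -/
theorem chanP_weighted_eq {m : ℕ} (hm : 1 ≤ m) (i : ℕ) {t : ℝ} (ht : 0 ≤ t) :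
    ((m : ℝ)⁻¹) ^ i * chanP m i t / (t + 1) ^ 2 =
      ((m : ℝ) - 1) * ((m : ℝ)⁻¹) ^ (2 * i + 1) *
        ((t + 1)⁻¹ * (t + (((m : ℝ) - 1) * ((m : ℝ)⁻¹) ^ (i + 1) + 1))⁻¹ *
          (1 + ((m : ℝ) - 1) * (1 - ((m : ℝ)⁻¹) ^ i) *
            (t + (((m : ℝ) - 1) * ((m : ℝ)⁻¹) ^ i + 1))⁻¹)) := by
  have hm1 : (1 : ℝ) ≤ m := by exact_mod_cast hm
  have hm0 : (m : ℝ) ≠ 0 := by positivity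
  have hpow : (m : ℝ) ^ (-(i : ℤ)) = ((m : ℝ)⁻¹) ^ i := by simp
  have hpow_succ : (m : ℝ) ^ (-(i : ℤ) - 1) = ((m : ℝ)⁻¹) ^ (i + 1) := by
    rw [zpow_sub_one₀ hm0, hpow, pow_succ]
  have hs : 0 ≤ (m : ℝ) - 1 := sub_nonneg.mpr hm1
  have ha : t + (((m : ℝ) - 1) * ((m : ℝ)⁻¹) ^ i + 1) ≠ 0 := by positivity
  have hb : t + (((m : ℝ) - 1) * ((m : ℝ)⁻¹) ^ (i + 1) + 1) ≠ 0 := by positivity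
  have ht1 : t + 1 ≠ 0 := by positivity
  have hsplit : 1 + ((m : ℝ) - 1) * (1 - ((m : ℝ)⁻¹) ^ i) *
      (t + (((m : ℝ) - 1) * ((m : ℝ)⁻¹) ^ i + 1))⁻¹ =
        (t + m) * (t + (((m : ℝ) - 1) * ((m : ℝ)⁻¹) ^ i + 1))⁻¹ := by
    generalize ((m : ℝ)⁻¹) ^ i = q at *
    field_simp
    ring
  have hodd : ((m : ℝ)⁻¹) ^ (2 * i + 1) = ((m : ℝ)⁻¹) ^ i * ((m : ℝ)⁻¹) ^ (i + 1) := by ring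
  rw [chanP, hpow, hpow_succ, hsplit, hodd, add_assoc t (_ * _) 1, add_assoc t (_ * _) 1]
  generalize ((m : ℝ)⁻¹) ^ i = q at *
  generalize ((m : ℝ)⁻¹) ^ (i + 1) = r at *
  field_simp

/-- for every `i ∈ ℕ`, the function
`h_m(x) = αⁱ·P_mⁱ((m-1)x)/((m-1)x+1)²` is decreasing on `[0,1]`; consequently
`αⁱ·P_mⁱ((m-1)x)/((m-1)x+1)² ≤ (m-1)α^{2i}/((m-1)α^{i+1}+1)²` for all `x ∈ [0,1]`. -/
theorem chan_h_antitone (m : ℕ) (hm : 2 ≤ m) :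
    ∀ i : ℕ,
      AntitoneOn
        (fun x => ((m : ℝ)⁻¹) ^ i * chanP m i (((m : ℝ) - 1) * x) /
          (((m : ℝ) - 1) * x + 1) ^ 2)
        (Set.Icc (0 : ℝ) 1) ∧
      ∀ x ∈ Set.Icc (0 : ℝ) 1,
        ((m : ℝ)⁻¹) ^ i * chanP m i (((m : ℝ) - 1) * x) / (((m : ℝ) - 1) * x + 1) ^ 2 ≤
          ((m : ℝ) - 1) * ((m : ℝ)⁻¹) ^ (2 * i) /
            (((m : ℝ) - 1) * ((m : ℝ)⁻¹) ^ (i + 1) + 1) ^ 2 := by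
  intro i
  have hm1 : (1 : ℝ) ≤ m := by exact_mod_cast one_le_two.trans hm
  have hs : 0 ≤ (m : ℝ) - 1 := sub_nonneg.mpr hm1
  have hq1 : ((m : ℝ)⁻¹) ^ i ≤ 1 := pow_le_one₀ (by positivity) (inv_le_one_of_one_le₀ hm1)
  have hanti : AntitoneOn
      (fun x => ((m : ℝ)⁻¹) ^ i * chanP m i (((m : ℝ) - 1) * x) /
        (((m : ℝ) - 1) * x + 1) ^ 2) (Set.Icc (0 : ℝ) 1) := by
    intro x hx y hy hxy
    have hx0 : 0 ≤ x := hx.1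
    have hy0 : 0 ≤ y := hy.1
    have hq : 0 ≤ 1 - ((m : ℝ)⁻¹) ^ i := sub_nonneg.mpr hq1
    beta_reduce
    rw [chanP_weighted_eq (one_le_two.trans hm) i (mul_nonneg hs hx0),
      chanP_weighted_eq (one_le_two.trans hm) i (mul_nonneg hs hy0)]
    gcongr
  refine ⟨hanti, fun x hx => (hanti (left_mem_Icc.mpr zero_le_one) hx hx.1).trans ?_⟩
  have hr : ((m : ℝ)⁻¹) ^ (i + 1) ≤ ((m : ℝ)⁻¹) ^ i :=
    pow_le_pow_of_le_one (by positivity) (inv_le_one_of_one_le₀ hm1) i.le_succ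
  have hb : 0 < ((m : ℝ) - 1) * ((m : ℝ)⁻¹) ^ (i + 1) + 1 := by positivity
  have hzero : ((m : ℝ)⁻¹) ^ i * chanP m i (((m : ℝ) - 1) * 0) / (((m : ℝ) - 1) * 0 + 1) ^ 2 =
      ((m : ℝ) - 1) * ((m : ℝ)⁻¹) ^ (2 * i) /
        ((((m : ℝ) - 1) * ((m : ℝ)⁻¹) ^ (i + 1) + 1) *
          (((m : ℝ) - 1) * ((m : ℝ)⁻¹) ^ i + 1)) := by
    have ha : ((m : ℝ) - 1) * ((m : ℝ)⁻¹) ^ i + 1 ≠ 0 := by positivity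
    have hm0 : (m : ℝ) ≠ 0 := by positivity
    rw [mul_zero, chanP_weighted_eq (one_le_two.trans hm) i le_rfl, zero_add, zero_add, zero_add,
      pow_succ _ (2 * i)]
    generalize ((m : ℝ)⁻¹) ^ (2 * i) = p at *
    generalize ((m : ℝ)⁻¹) ^ (i + 1) = r at *
    generalize ((m : ℝ)⁻¹) ^ i = q at *
    field_simp
    ring
  beta_reduce
  rw [hzero, sq]
  gcongr
end

section
/- (Contraction estimate) Let f : [0,1] → ℝ be continuously differentiable and define g(x) = Σ_{i=0}^{∞} P_mⁱ((m−1)x) · f( αⁱ/(1+(m−1)x) ) for x ∈ [0,1], where α = 1/m. Then g is differentiable on [0,1] and max_{x∈[0,1]} |g′(x)| ≤ q_m · max_{x∈[0,1]} |f′(x)|, where q_m = (m−1)²(m²+1) · Σ_{i=0}^{∞} 1/(m^{i+1}+m−1)². -/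
open Set

/-- The contraction constant `q_m = (m-1)²(m²+1)·Σ_i 1/(m^{i+1}+m-1)²`. -/
noncomputable def chanQ (m : ℕ) : ℝ :=
  ((m : ℝ) - 1) ^ 2 * ((m : ℝ) ^ 2 + 1) *
    ∑' i : ℕ, 1 / ((m : ℝ) ^ (i + 1) + (m : ℝ) - 1) ^ 2

/-- A function with continuous derivative on `[0,1]` extends to a differentiable function on `ℝ`
whose derivative is nowhere larger than the supremum of the original one. -/
lemma exists_hasDerivAt_extension {f f' : ℝ → ℝ}
    (hf : ∀ x ∈ Icc (0 : ℝ) 1, HasDerivWithinAt f (f' x) (Icc (0 : ℝ) 1) x)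
    (hf' : ContinuousOn f' (Icc (0 : ℝ) 1)) :
    ∃ F F' : ℝ → ℝ, (∀ x, HasDerivAt F (F' x) x) ∧
      (∀ x, |F' x| ≤ ⨆ t : Icc (0 : ℝ) 1, |f' t|) ∧ EqOn f F (Icc 0 1) := by
  set F' : ℝ → ℝ := IccExtend (zero_le_one' ℝ) (fun t : Icc (0 : ℝ) 1 => f' t) with hF'
  have hcont : Continuous F' := by
    have h : Continuous (fun t : Icc (0 : ℝ) 1 => f' t) :=
      continuousOn_iff_continuous_domRestrict.1 hf'
    exact h.Icc_extend'
  have hbdd : BddAbove (range fun t : Icc (0 : ℝ) 1 => |f' t|) := by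
    have h := (isCompact_Icc.image_of_continuousOn hf'.abs).bddAbove
    rwa [image_eq_range] at h
  have hderiv (x : ℝ) : HasDerivAt (fun x => f 0 + ∫ t in (0 : ℝ)..x, F' t) (F' x) x :=
    (intervalIntegral.integral_hasDerivAt_right (hcont.intervalIntegrable _ _)
      (hcont.stronglyMeasurableAtFilter _ _) hcont.continuousAt).const_add _
  refine ⟨fun x => f 0 + ∫ t in (0 : ℝ)..x, F' t, F', hderiv,
    fun x => le_ciSup hbdd (projIcc 0 1 zero_le_one x), fun x hx => ?_⟩
  have h := (convex_Icc (0 : ℝ) 1).norm_image_sub_le_of_norm_hasDerivWithin_le (C := 0)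
    (fun y hy => (hf y hy).sub (hderiv y).hasDerivWithinAt)
    (fun y hy => by simp [hF', IccExtend_of_mem _ _ hy]) (left_mem_Icc.2 zero_le_one) hx
  simp only [zero_mul, norm_le_zero_iff] at h
  simp at h
  simp only
  linarith

/-- A differentiable function with derivative bounded by `M` is `M`-Lipschitz. -/
lemma abs_sub_le_of_hasDerivAt {F F' : ℝ → ℝ} {M : ℝ} (hF : ∀ x, HasDerivAt F (F' x) x)
    (hM : ∀ x, |F' x| ≤ M) (x y : ℝ) : |F y - F x| ≤ M * |y - x| :=
  convex_univ.norm_image_sub_le_of_norm_hasDerivWithin_le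
    (fun z _ => (hF z).hasDerivWithinAt) (fun z _ => hM z) (mem_univ x) (mem_univ y)

lemma mul_inv_pow_succ {k : ℝ} (hk : k ≠ 0) (i : ℕ) : k * k⁻¹ ^ (i + 1) = k⁻¹ ^ i := by
  rw [pow_succ', mul_inv_cancel_left₀ hk]

/-- The weight `P_mⁱ` in the variables `y = t + 1` and `s = m^{-(i+1)}`. -/
noncomputable def chanWeight (k s y : ℝ) : ℝ :=
  (k - 1) * s * y * (y + k - 1) / ((y + (k - 1) * (k * s)) * (y + (k - 1) * s))

/-- The partial sum `∑_{j < i} P_mʲ` in the variables `y = t + 1` and `s = m^{-i}`. -/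
noncomputable def chanPartial (k s y : ℝ) : ℝ := y * (1 - s) / (y + (k - 1) * s)

/-- The `y`-derivative of `chanPartial`. -/
noncomputable def chanPartialDeriv (k s y : ℝ) : ℝ :=
  (1 - s) * ((k - 1) * s) / (y + (k - 1) * s) ^ 2

section

variable {k s y : ℝ}

lemma chanWeight_eq_sub (hk : 1 < k) (hs : 0 < s) (hy : 0 < y) :
    chanWeight k s y = chanPartial k s y - chanPartial k (k * s) y := by
  have h1 : 0 < k - 1 := by linarith
  have h2 : 0 < y + (k - 1) * s := by positivity
  have h3 : 0 < y + (k - 1) * (k * s) := by positivity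
  unfold chanWeight chanPartial
  field_simp
  ring

lemma hasDerivAt_chanPartial (hk : 1 < k) (hs : 0 < s) (hy : 0 < y) :
    HasDerivAt (chanPartial k s) (chanPartialDeriv k s y) y := by
  have h1 : 0 < k - 1 := by linarith
  have h2 : 0 < y + (k - 1) * s := by positivity
  have h := ((hasDerivAt_id y).mul_const (1 - s)).div
    ((hasDerivAt_id y).add_const ((k - 1) * s)) h2.ne'
  refine h.congr_deriv ?_
  simp only [chanPartialDeriv, id]
  congr 1
  ring

lemma hasDerivAt_chanWeight (hk : 1 < k) (hs : 0 < s) (hy : 0 < y) :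
    HasDerivAt (chanWeight k s) (chanPartialDeriv k s y - chanPartialDeriv k (k * s) y) y := by
  have hks : 0 < k * s := by positivity
  refine ((hasDerivAt_chanPartial hk hs hy).sub
    (hasDerivAt_chanPartial hk hks hy)).congr_of_eventuallyEq ?_
  filter_upwards [lt_mem_nhds hy] with z hz using chanWeight_eq_sub hk hs hz

lemma chanPartialDeriv_nonneg (hk : 1 < k) (hs : 0 < s) (hs1 : s ≤ 1) :
    0 ≤ chanPartialDeriv k s y := by
  have h1 : 0 < k - 1 := by linarith
  have h2 : 0 ≤ 1 - s := by linarith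
  unfold chanPartialDeriv
  positivity

lemma chanPartialDeriv_le (hk : 1 < k) (hs : 0 < s) (hy : 1 / 2 < y) :
    chanPartialDeriv k s y ≤ 4 * (k - 1) * s := by
  have h1 : 0 < k - 1 := by linarith
  have h3 : 0 < (k - 1) * s := by positivity
  unfold chanPartialDeriv
  rw [div_le_iff₀ (by positivity)]
  have h4 : 1 / 4 ≤ (y + (k - 1) * s) ^ 2 := by nlinarith
  nlinarith

lemma chanWeight_nonneg (hk : 1 < k) (hs : 0 < s) (hy : 0 < y) : 0 ≤ chanWeight k s y := by
  have h1 : 0 < k - 1 := by linarith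
  have h2 : 0 < y + k - 1 := by linarith
  unfold chanWeight
  positivity

lemma chanWeight_le (hk : 1 < k) (hs : 0 < s) (hy : 1 / 2 < y) :
    chanWeight k s y ≤ (k - 1) * (2 * k) * s := by
  have h1 : 0 < k - 1 := by linarith
  have h3 : 0 < (k - 1) * s := by positivity
  have hy0 : 0 < y := by linarith
  have h2 : y + k - 1 ≤ 2 * k * y := by nlinarith
  unfold chanWeight
  rw [div_le_iff₀ (by positivity)]
  calc (k - 1) * s * y * (y + k - 1) ≤ (k - 1) * s * y * (2 * k * y) := by gcongr
    _ = (k - 1) * (2 * k) * s * (y * y) := by ring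
    _ ≤ (k - 1) * (2 * k) * s * ((y + (k - 1) * (k * s)) * (y + (k - 1) * s)) := by
      gcongr <;> linarith [show 0 < (k - 1) * (k * s) by positivity]

lemma chanPartialDeriv_mul_le (hk : 1 < k) (hs : 0 < s) (hs1 : s ≤ 1) (hy : 1 ≤ y) :
    chanPartialDeriv k s y * ((k - 1) * s / y) ≤
      (k - 1) ^ 2 * (1 - s) * (1 / (s⁻¹ + k - 1) ^ 2) := by
  have h1 : 0 < k - 1 := by linarith
  have h2 : 0 ≤ 1 - s := by linarith
  have h3 : 1 + (k - 1) * s = s * (s⁻¹ + k - 1) := by field_simp; ring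
  have h4 : 0 < s⁻¹ + k - 1 := by have := inv_pos.2 hs; linarith
  unfold chanPartialDeriv
  calc (1 - s) * ((k - 1) * s) / (y + (k - 1) * s) ^ 2 * ((k - 1) * s / y)
      ≤ (1 - s) * ((k - 1) * s) / (1 + (k - 1) * s) ^ 2 * ((k - 1) * s / 1) := by gcongr
    _ = _ := by rw [h3]; field_simp

lemma chanWeight_mul_le_at_one (hk : 1 < k) (hs : 0 < s) (hks : k * s ≤ 1) (hy : 1 ≤ y) :
    chanWeight k s y * (k * s / y ^ 2) ≤
      (k - 1) * k ^ 2 * s ^ 2 / ((1 + (k - 1) * (k * s)) * (1 + (k - 1) * s)) := by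
  have h1 : 0 < k - 1 := by linarith
  have hy0 : 0 < y := by linarith
  have hA : 0 < (k - 1) * (k * s) := by positivity
  have h2 : (y + k - 1) / (y + (k - 1) * (k * s)) ≤ k / (1 + (k - 1) * (k * s)) := by
    rw [div_le_div_iff₀ (by positivity) (by positivity)]
    nlinarith [mul_nonneg (mul_nonneg h1.le (sub_nonneg.2 hks)) (sub_nonneg.2 hy)]
  calc chanWeight k s y * (k * s / y ^ 2)
      = (k - 1) * k * s ^ 2 * ((y + k - 1) / (y + (k - 1) * (k * s))) /
          (y * (y + (k - 1) * s)) := by unfold chanWeight; field_simp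
    _ ≤ (k - 1) * k * s ^ 2 * (k / (1 + (k - 1) * (k * s))) / (1 * (1 + (k - 1) * s)) := by
      gcongr
    _ = _ := by field_simp

lemma chanWeight_mul_le (hk : 1 < k) (hs : 0 < s) (hks : k * s ≤ 1) (hy : 1 ≤ y) :
    chanWeight k s y * (k * s / y ^ 2) ≤ (k - 1) * k ^ 2 * (1 / (s⁻¹ + k - 1) ^ 2) := by
  have h1 : 0 < k - 1 := by linarith
  have h3 : 1 + (k - 1) * s = s * (s⁻¹ + k - 1) := by field_simp; ring
  have h4 : 0 < s⁻¹ + k - 1 := by have := inv_pos.2 hs; linarith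
  calc _ ≤ _ := chanWeight_mul_le_at_one hk hs hks hy
    _ ≤ (k - 1) * k ^ 2 * s ^ 2 / ((1 + (k - 1) * s) * (1 + (k - 1) * s)) := by
      gcongr
      nlinarith
    _ = _ := by rw [h3]; field_simp

lemma chanWeight_inv_mul_le (hk : 1 < k) (hy : 1 ≤ y) :
    chanWeight k k⁻¹ y * (k * k⁻¹ / y ^ 2) ≤ (k - 1) * (2 * k - 1) * (1 / (k + k - 1) ^ 2) := by
  have h1 : 0 < k - 1 := by linarith
  have h2 : 0 < 2 * k - 1 := by linarith
  have hk0 : k ≠ 0 := by linarith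
  refine (chanWeight_mul_le_at_one hk (by positivity) (by simp [hk0]) hy).trans_eq ?_
  have h3 : 1 + (k - 1) * k⁻¹ = (2 * k - 1) / k := by field_simp; ring
  rw [h3, mul_inv_cancel₀ hk0, show k + k - 1 = 2 * k - 1 by ring]
  field_simp
  ring

end

/-- The summand `1/(m^{i+1}+m-1)²` of `chanQ`. -/
noncomputable def chanCoeff (k : ℝ) (i : ℕ) : ℝ := 1 / (k ^ (i + 1) + k - 1) ^ 2

lemma chanCoeff_nonneg (k : ℝ) (i : ℕ) : 0 ≤ chanCoeff k i := by unfold chanCoeff; positivity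

lemma chanCoeff_succ_le {k : ℝ} (hk : 2 ≤ k) (i : ℕ) :
    chanCoeff k (i + 1) ≤ 1 / 2 * chanCoeff k i := by
  unfold chanCoeff
  have hp : k ≤ k ^ (i + 1) := le_self_pow₀ (by linarith) (by simp)
  rw [pow_succ k (i + 1)]
  generalize k ^ (i + 1) = p at *
  have h1 : 0 < p + k - 1 := by linarith
  have h2 : 3 / 2 * (p + k - 1) ≤ p * k + k - 1 := by nlinarith
  have h3 : 2 * (p + k - 1) ^ 2 ≤ (p * k + k - 1) ^ 2 := by nlinarith
  rw [div_mul_div_comm, one_mul]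
  gcongr

lemma summable_chanCoeff {k : ℝ} (hk : 2 ≤ k) : Summable (chanCoeff k) := by
  refine summable_of_ratio_norm_eventually_le (r := 1 / 2) (by norm_num) (.of_forall fun i => ?_)
  simpa only [Real.norm_of_nonneg (chanCoeff_nonneg k _)] using chanCoeff_succ_le hk i

lemma tsum_chanCoeff_le {k : ℝ} (hk : 2 ≤ k) : ∑' i, chanCoeff k i ≤ 2 * chanCoeff k 0 := by
  have hs := summable_chanCoeff hk
  have h1 := ((summable_nat_add_iff 1).2 hs).tsum_le_tsum (chanCoeff_succ_le hk) (hs.mul_left _)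
  rw [tsum_mul_left] at h1
  have h2 := hs.tsum_eq_zero_add
  linarith

/-- Majorant of the `i`-th term of the rearranged derivative series. -/
noncomputable def chanMajorant (k : ℝ) (i : ℕ) : ℝ :=
  (k - 1) * ((k ^ 2 + k - 1) * chanCoeff k i - if i = 0 then (k - 1) ^ 2 * chanCoeff k 0 else 0)

lemma hasSum_chanMajorant {k : ℝ} (hk : 2 ≤ k) :
    HasSum (chanMajorant k)
      ((k - 1) * ((k ^ 2 + k - 1) * ∑' i, chanCoeff k i - (k - 1) ^ 2 * chanCoeff k 0)) :=
  (((summable_chanCoeff hk).hasSum.mul_left _).sub (hasSum_ite_eq 0 _)).mul_left _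

lemma tsum_chanMajorant_le {k : ℝ} (hk : 2 ≤ k) :
    ∑' i, chanMajorant k i ≤ (k - 1) * (k ^ 2 + 1) * ∑' i, chanCoeff k i := by
  rw [(hasSum_chanMajorant hk).tsum_eq, mul_assoc]
  have h0 := chanCoeff_nonneg k 0
  have h := tsum_chanCoeff_le hk
  gcongr
  · linarith
  · nlinarith [mul_nonneg (sub_nonneg.2 hk) (sub_nonneg.2 h), mul_nonneg h0 (sq_nonneg (k - 2))]

lemma chan_terms_le_majorant {k y : ℝ} (hk : 2 ≤ k) (hy : 1 ≤ y) (i : ℕ) :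
    chanPartialDeriv k (k⁻¹ ^ (i + 1)) y * ((k - 1) * k⁻¹ ^ (i + 1) / y) +
      chanWeight k (k⁻¹ ^ (i + 1)) y * (k⁻¹ ^ i / y ^ 2) ≤ chanMajorant k i := by
  have hk1 : 1 < k := by linarith
  have hk0 : 0 < k := by linarith
  have hs : 0 < k⁻¹ ^ (i + 1) := by positivity
  have hr := (mul_inv_pow_succ hk0.ne' i).symm
  have hle (j : ℕ) : k⁻¹ ^ j ≤ 1 := pow_le_one₀ (by positivity) (inv_le_one_of_one_le₀ hk1.le)
  have h1 := chanPartialDeriv_mul_le hk1 hs (hle _) hy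
  have hinv : (k⁻¹ ^ (i + 1))⁻¹ = k ^ (i + 1) := by rw [← inv_pow, inv_inv]
  rw [hinv] at h1
  have hc := chanCoeff_nonneg k i
  rcases eq_or_ne i 0 with rfl | hi
  · have h2 := chanWeight_inv_mul_le hk1 hy
    simp only [chanMajorant, chanCoeff, zero_add, pow_one, if_true, pow_zero] at *
    rw [mul_inv_cancel₀ hk0.ne'] at h2
    refine (add_le_add h1 h2).trans ?_
    have h3 : (k - 1) ^ 2 * (1 - k⁻¹) ≤ (k - 1) ^ 2 :=
      mul_le_of_le_one_right (sq_nonneg _) (by simp [hk0.le])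
    nlinarith [mul_le_mul_of_nonneg_right h3 hc]
  · have h2 := chanWeight_mul_le hk1 hs (hr ▸ hle i) hy
    rw [hinv, ← hr] at h2
    refine (add_le_add h1 h2).trans ?_
    simp only [chanMajorant, if_neg hi, sub_zero]
    change (k - 1) ^ 2 * (1 - k⁻¹ ^ (i + 1)) * chanCoeff k i + (k - 1) * k ^ 2 * chanCoeff k i ≤ _
    nlinarith [mul_nonneg (mul_nonneg (sq_nonneg (k - 1)) hs.le) hc]

/-- The operator of the contraction estimate, in the variable `y = 1 + (m-1)x`. -/
noncomputable def chanOperator (k : ℝ) (F : ℝ → ℝ) (y : ℝ) : ℝ :=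
  ∑' i : ℕ, chanWeight k (k⁻¹ ^ (i + 1)) y * F (k⁻¹ ^ i / y)

/-- The derivative of the `i`-th summand of `chanOperator`. -/
noncomputable def chanTermDeriv (k : ℝ) (F F' : ℝ → ℝ) (i : ℕ) (y : ℝ) : ℝ :=
  (chanPartialDeriv k (k⁻¹ ^ (i + 1)) y - chanPartialDeriv k (k⁻¹ ^ i) y) * F (k⁻¹ ^ i / y) -
    chanWeight k (k⁻¹ ^ (i + 1)) y * (k⁻¹ ^ i / y ^ 2 * F' (k⁻¹ ^ i / y))

section

variable {k y M : ℝ} {F F' : ℝ → ℝ}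

lemma hasDerivAt_chanTerm (hk : 1 < k) (hF : ∀ x, HasDerivAt F (F' x) x) (hy : 0 < y) (i : ℕ) :
    HasDerivAt (fun y => chanWeight k (k⁻¹ ^ (i + 1)) y * F (k⁻¹ ^ i / y))
      (chanTermDeriv k F F' i y) y := by
  have hk0 : 0 < k := by linarith
  have hr := mul_inv_pow_succ hk0.ne' i
  have h1 := hasDerivAt_chanWeight hk (show 0 < k⁻¹ ^ (i + 1) by positivity) hy
  have h2 : HasDerivAt (fun y => k⁻¹ ^ i / y) (-(k⁻¹ ^ i / y ^ 2)) y :=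
    ((hasDerivAt_inv hy.ne').const_mul (k⁻¹ ^ i)).congr_deriv (by field_simp)
  rw [hr] at h1
  refine (h1.mul ((hF _).comp y h2)).congr_deriv ?_
  simp only [chanTermDeriv, Function.comp]
  ring

lemma abs_apply_div_le (hk : 1 < k) (hF : ∀ x, HasDerivAt F (F' x) x) (hM : ∀ x, |F' x| ≤ M)
    (hy : 1 / 2 < y) (i : ℕ) : |F (k⁻¹ ^ i / y)| ≤ |F 0| + 2 * M := by
  have hk0 : 0 < k := by linarith
  have hy0 : 0 < y := by linarith
  have hM0 : 0 ≤ M := (abs_nonneg _).trans (hM 0)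
  have h := abs_sub_le_of_hasDerivAt hF hM 0 (k⁻¹ ^ i / y)
  have hle : k⁻¹ ^ i ≤ 1 := pow_le_one₀ (by positivity) (inv_le_one_of_one_le₀ hk.le)
  have h2 : k⁻¹ ^ i / y ≤ 2 := by rw [div_le_iff₀ hy0]; linarith
  rw [sub_zero, abs_of_nonneg (show 0 ≤ k⁻¹ ^ i / y by positivity)] at h
  have h3 := abs_sub_abs_le_abs_sub (F (k⁻¹ ^ i / y)) (F 0)
  nlinarith

lemma abs_chanTermDeriv_le (hk : 1 < k) (hF : ∀ x, HasDerivAt F (F' x) x)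
    (hM : ∀ x, |F' x| ≤ M) (hy : 1 / 2 < y) (i : ℕ) :
    |chanTermDeriv k F F' i y| ≤
      (8 * (k - 1) * (|F 0| + 2 * M) + 8 * k * (k - 1) * M) * k⁻¹ ^ i := by
  have hk0 : 0 < k := by linarith
  have hk1 : 0 < k - 1 := by linarith
  have hy0 : 0 < y := by linarith
  have hM0 : 0 ≤ M := (abs_nonneg _).trans (hM 0)
  have hle (j : ℕ) : k⁻¹ ^ j ≤ 1 := pow_le_one₀ (by positivity) (inv_le_one_of_one_le₀ hk.le)
  have hpos (j : ℕ) : 0 < k⁻¹ ^ j := by positivity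
  have hsr : k⁻¹ ^ (i + 1) ≤ k⁻¹ ^ i :=
    pow_le_pow_of_le_one (by positivity) (inv_le_one_of_one_le₀ hk.le) (by simp)
  have hD (j : ℕ) := chanPartialDeriv_nonneg (y := y) hk (hpos j) (hle j)
  have hD' (j : ℕ) := chanPartialDeriv_le hk (hpos j) hy
  have hW := chanWeight_nonneg hk (hpos (i + 1)) hy0
  have hW' := chanWeight_le hk (hpos (i + 1)) hy
  have hA : |chanPartialDeriv k (k⁻¹ ^ (i + 1)) y - chanPartialDeriv k (k⁻¹ ^ i) y| ≤
      8 * (k - 1) * k⁻¹ ^ i := by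
    have h5 : 4 * (k - 1) * k⁻¹ ^ (i + 1) ≤ 4 * (k - 1) * k⁻¹ ^ i := by gcongr
    rw [abs_le]
    constructor <;> linarith [hD i, hD (i + 1), hD' i, hD' (i + 1)]
  have hB : k⁻¹ ^ i / y ^ 2 ≤ 4 * k⁻¹ ^ i := by
    rw [div_le_iff₀ (by positivity)]
    have : 1 / 4 ≤ y ^ 2 := by nlinarith
    nlinarith [hpos i]
  have hC : chanWeight k (k⁻¹ ^ (i + 1)) y ≤ 2 * k * (k - 1) :=
    hW'.trans (by nlinarith [hle (i + 1), mul_pos hk0 hk1])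
  unfold chanTermDeriv
  refine (abs_sub _ _).trans ?_
  rw [abs_mul, abs_mul, abs_mul, abs_of_nonneg hW,
    abs_of_nonneg (show 0 ≤ k⁻¹ ^ i / y ^ 2 by positivity)]
  calc _ ≤ 8 * (k - 1) * k⁻¹ ^ i * (|F 0| + 2 * M) +
        2 * k * (k - 1) * (4 * k⁻¹ ^ i * M) := by
        gcongr
        · exact abs_apply_div_le hk hF hM hy i
        · exact hM _
    _ = _ := by ring

lemma summable_const_mul_inv_pow (hk : 1 < k) (C : ℝ) : Summable fun i : ℕ => C * k⁻¹ ^ i :=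
  (summable_geometric_of_lt_one (by positivity) (inv_lt_one_of_one_lt₀ hk)).mul_left C

lemma hasDerivAt_chanOperator (hk : 1 < k) (hF : ∀ x, HasDerivAt F (F' x) x)
    (hM : ∀ x, |F' x| ≤ M) (hy : 1 ≤ y) :
    HasDerivAt (chanOperator k F) (∑' i, chanTermDeriv k F F' i y) y := by
  have hk0 : 0 < k := by linarith
  refine hasDerivAt_tsum_of_isPreconnected (t := Ioi (1 / 2)) (y₀ := 1)
    (summable_const_mul_inv_pow hk _) isOpen_Ioi isPreconnected_Ioi
    (fun i z hz => hasDerivAt_chanTerm hk hF (lt_trans (by norm_num) hz) i)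
    (fun i z hz => abs_chanTermDeriv_le hk hF hM hz i) (by norm_num [mem_Ioi]) ?_
    (lt_of_lt_of_le (by norm_num) hy)
  refine Summable.of_norm_bounded
    (summable_const_mul_inv_pow hk ((k - 1) * 2 * (|F 0| + 2 * M))) fun i => ?_
  have hs : 0 < k⁻¹ ^ (i + 1) := by positivity
  have h1 := chanWeight_le hk hs (show (1 : ℝ) / 2 < 1 by norm_num)
  have hr := mul_inv_pow_succ hk0.ne' i
  rw [Real.norm_eq_abs, abs_mul, abs_of_nonneg (chanWeight_nonneg hk hs one_pos)]
  calc _ ≤ (k - 1) * (2 * k) * k⁻¹ ^ (i + 1) * (|F 0| + 2 * M) :=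
        mul_le_mul h1 (abs_apply_div_le hk hF hM (by norm_num) i) (abs_nonneg _)
          ((chanWeight_nonneg hk hs one_pos).trans h1)
    _ = (k - 1) * 2 * (|F 0| + 2 * M) * (k * k⁻¹ ^ (i + 1)) := by ring
    _ = _ := by rw [hr]

lemma abs_tsum_chanTermDeriv_le (hk : 2 ≤ k) (hF : ∀ x, HasDerivAt F (F' x) x)
    (hM : ∀ x, |F' x| ≤ M) (hy : 1 ≤ y) :
    |∑' i, chanTermDeriv k F F' i y| ≤ M * ∑' i, chanMajorant k i := by
  have hk1 : 1 < k := by linarith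
  have hk0 : 0 < k := by linarith
  have hy0 : 0 < y := by linarith
  have hy2 : 1 / 2 < y := by linarith
  have hM0 : 0 ≤ M := (abs_nonneg _).trans (hM 0)
  have hle (j : ℕ) : k⁻¹ ^ j ≤ 1 := pow_le_one₀ (by positivity) (inv_le_one_of_one_le₀ hk1.le)
  have hpos (j : ℕ) : 0 < k⁻¹ ^ j := by positivity
  set E : ℕ → ℝ := fun i => chanPartialDeriv k (k⁻¹ ^ i) y * F (k⁻¹ ^ i / y) with hE
  set B : ℕ → ℝ := fun i => chanTermDeriv k F F' i y - (E (i + 1) - E i) with hB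
  have hBle (i : ℕ) : ‖B i‖ ≤ M * chanMajorant k i := by
    have hBi : B i = chanPartialDeriv k (k⁻¹ ^ (i + 1)) y *
        (F (k⁻¹ ^ i / y) - F (k⁻¹ ^ (i + 1) / y)) -
        chanWeight k (k⁻¹ ^ (i + 1)) y * (k⁻¹ ^ i / y ^ 2 * F' (k⁻¹ ^ i / y)) := by
      simp only [hB, hE, chanTermDeriv]; ring
    have hgap : k⁻¹ ^ i / y - k⁻¹ ^ (i + 1) / y = (k - 1) * k⁻¹ ^ (i + 1) / y := by
      rw [← mul_inv_pow_succ hk0.ne' i]; ring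
    have hlip := abs_sub_le_of_hasDerivAt hF hM (k⁻¹ ^ (i + 1) / y) (k⁻¹ ^ i / y)
    have hk1' : 0 < k - 1 := by linarith
    rw [hgap, abs_of_nonneg (show 0 ≤ (k - 1) * k⁻¹ ^ (i + 1) / y by positivity)] at hlip
    have hD := chanPartialDeriv_nonneg (y := y) hk1 (hpos (i + 1)) (hle (i + 1))
    have hW := chanWeight_nonneg hk1 (hpos (i + 1)) hy0
    rw [hBi, Real.norm_eq_abs]
    refine (abs_sub _ _).trans ?_
    rw [abs_mul, abs_mul, abs_mul, abs_of_nonneg hW, abs_of_nonneg hD,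
      abs_of_nonneg (show 0 ≤ k⁻¹ ^ i / y ^ 2 by positivity)]
    calc _ ≤ chanPartialDeriv k (k⁻¹ ^ (i + 1)) y * (M * ((k - 1) * k⁻¹ ^ (i + 1) / y)) +
          chanWeight k (k⁻¹ ^ (i + 1)) y * (k⁻¹ ^ i / y ^ 2 * M) := by
          gcongr
          exact hM _
      _ = M * (chanPartialDeriv k (k⁻¹ ^ (i + 1)) y * ((k - 1) * k⁻¹ ^ (i + 1) / y) +
          chanWeight k (k⁻¹ ^ (i + 1)) y * (k⁻¹ ^ i / y ^ 2)) := by ring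
      _ ≤ _ := by gcongr; exact chan_terms_le_majorant hk hy i
  have hmaj := (hasSum_chanMajorant hk).summable.mul_left M
  have hBs : Summable B := .of_norm_bounded hmaj hBle
  have hTs : Summable fun i => chanTermDeriv k F F' i y :=
    .of_norm_bounded (summable_const_mul_inv_pow hk1 _)
      fun i => abs_chanTermDeriv_le hk1 hF hM hy2 i
  have hElim : Filter.Tendsto E Filter.atTop (nhds 0) := by
    have h := (summable_const_mul_inv_pow hk1 (4 * (k - 1) * (|F 0| + 2 * M))).tendsto_atTop_zero
    refine squeeze_zero_norm (fun i => ?_) h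
    have hD := chanPartialDeriv_nonneg (y := y) hk1 (hpos i) (hle i)
    have hD' := chanPartialDeriv_le hk1 (hpos i) hy2
    rw [hE, Real.norm_eq_abs, abs_mul, abs_of_nonneg hD]
    calc _ ≤ 4 * (k - 1) * k⁻¹ ^ i * (|F 0| + 2 * M) :=
          mul_le_mul hD' (abs_apply_div_le hk1 hF hM hy2 i) (abs_nonneg _) (hD.trans hD')
      _ = _ := by ring
  have hdiff : Summable fun i => E (i + 1) - E i := by
    simpa [hB] using hTs.sub hBs
  have hzero : ∑' i, (E (i + 1) - E i) = 0 := by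
    refine tendsto_nhds_unique hdiff.hasSum.tendsto_sum_nat ?_
    have hE0 : E 0 = 0 := by simp [hE, chanPartialDeriv]
    simpa only [Finset.sum_range_sub, hE0, sub_zero] using hElim
  have hsum : ∑' i, chanTermDeriv k F F' i y = ∑' i, B i := by
    rw [hTs.tsum_sub hdiff, hzero, sub_zero]
  rw [hsum, ← tsum_mul_left]
  exact tsum_of_norm_bounded hmaj.hasSum hBle

end

lemma chanP_eq_chanWeight {m : ℕ} (hm : m ≠ 0) (i : ℕ) (t : ℝ) :
    chanP m i t = chanWeight m ((m : ℝ)⁻¹ ^ (i + 1)) (1 + t) := by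
  have hm' : (m : ℝ) ≠ 0 := Nat.cast_ne_zero.2 hm
  have h1 : (m : ℝ) ^ (-(i : ℤ)) = m * (m : ℝ)⁻¹ ^ (i + 1) := by
    rw [zpow_neg, zpow_natCast, mul_inv_pow_succ hm', inv_pow]
  have h2 : (m : ℝ) ^ (-(i : ℤ) - 1) = (m : ℝ)⁻¹ ^ (i + 1) := by
    rw [inv_pow, ← zpow_natCast, ← zpow_neg]; congr 1; push_cast; ring
  rw [chanP, chanWeight, h1, h2]
  congr 1 <;> ring

/-- contraction estimate: if `f : [0,1] → ℝ` is continuously differentiable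
and `g(x) = Σ_i P_mⁱ((m-1)x)·f(αⁱ/(1+(m-1)x))` with `α = 1/m`, then `g` is differentiable
on `[0,1]` and `max_{[0,1]} |g′| ≤ q_m · max_{[0,1]} |f′|`. -/
theorem chan_contraction (m : ℕ) (hm : 2 ≤ m)
    (f f' g : ℝ → ℝ)
    (hf : ∀ x ∈ Set.Icc (0 : ℝ) 1, HasDerivWithinAt f (f' x) (Set.Icc (0 : ℝ) 1) x)
    (hf' : ContinuousOn f' (Set.Icc (0 : ℝ) 1))
    (hg : ∀ x ∈ Set.Icc (0 : ℝ) 1,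
      g x = ∑' i : ℕ,
        chanP m i (((m : ℝ) - 1) * x) * f (((m : ℝ)⁻¹) ^ i / (1 + ((m : ℝ) - 1) * x))) :
    ∃ g' : ℝ → ℝ,
      (∀ x ∈ Set.Icc (0 : ℝ) 1, HasDerivWithinAt g (g' x) (Set.Icc (0 : ℝ) 1) x) ∧
      ∀ x ∈ Set.Icc (0 : ℝ) 1,
        |g' x| ≤ chanQ m * ⨆ t : Set.Icc (0 : ℝ) 1, |f' t| := by
  set k : ℝ := (m : ℝ) with hkdef
  have hk : 2 ≤ k := by rw [hkdef]; exact_mod_cast hm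
  obtain ⟨F, F', hF, hM, hfF⟩ := exists_hasDerivAt_extension hf hf'
  have hy {x : ℝ} (hx : x ∈ Icc (0 : ℝ) 1) : 1 ≤ 1 + (k - 1) * x := by
    have := mul_nonneg (show 0 ≤ k - 1 by linarith) hx.1
    linarith
  have hgF {x : ℝ} (hx : x ∈ Icc (0 : ℝ) 1) : g x = chanOperator k F (1 + (k - 1) * x) := by
    rw [hg x hx, chanOperator]
    refine tsum_congr fun i => ?_
    have hr : k⁻¹ ^ i ≤ 1 :=
      pow_le_one₀ (by positivity) (inv_le_one_of_one_le₀ (by linarith))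
    have hy1 := hy hx
    rw [chanP_eq_chanWeight (by omega), hfF ⟨by positivity, div_le_one_of_le₀ (by linarith)
      (by linarith)⟩]
  refine ⟨fun x => (∑' i, chanTermDeriv k F F' i (1 + (k - 1) * x)) * (k - 1),
    fun x hx => ?_, fun x hx => ?_⟩
  · have haff : HasDerivAt (fun x => 1 + (k - 1) * x) (k - 1) x := by
      simpa using ((hasDerivAt_id x).const_mul (k - 1)).const_add 1
    have h := (hasDerivAt_chanOperator (by linarith) hF hM (hy hx)).comp x haff
    exact h.hasDerivWithinAt.congr (fun z hz => hgF hz) (hgF hx)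
  · have hM0 := (abs_nonneg _).trans (hM 0)
    have hk1 : 0 ≤ k - 1 := by linarith
    rw [abs_mul, abs_of_nonneg hk1]
    calc _ ≤ (⨆ t : Icc (0 : ℝ) 1, |f' t|) *
          ((k - 1) * (k ^ 2 + 1) * ∑' i, chanCoeff k i) * (k - 1) := by
          gcongr
          exact (abs_tsum_chanTermDeriv_le hk hF hM (hy hx)).trans
            (mul_le_mul_of_nonneg_left (tsum_chanMajorant_le hk) hM0)
      _ = _ := by simp only [chanQ, chanCoeff, ← hkdef]; ring
end

section
/- In the case m = 2 the contraction constant is strictly less than one: q_2 = 5 · Σ_{i=0}^{∞} 1/(2^{i+1}+1)² < 1. -/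
/-- Each term of the series is dominated by a geometric sequence of ratio `1 / 4`. -/
lemma one_div_two_pow_succ_add_one_sq_le (i : ℕ) :
    1 / ((2 : ℝ) ^ (i + 1) + 1) ^ 2 ≤ 1 / 4 * (1 / 4 : ℝ) ^ i := by
  have h : 1 / 4 * (1 / 4 : ℝ) ^ i = 1 / ((2 : ℝ) ^ (i + 1)) ^ 2 := by
    rw [← pow_succ', one_div_pow, ← pow_mul, mul_comm, pow_mul]
    norm_num
  rw [h]
  gcongr
  linarith

/-- in the case `m = 2` the contraction constant is strictly less than one:
`q_2 = 5·Σ_{i=0}^{∞} 1/(2^{i+1}+1)² < 1`. -/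
theorem chanQ_two_lt_one :
    5 * (∑' i : ℕ, 1 / ((2 : ℝ) ^ (i + 1) + 1) ^ 2) < 1 := by
  have hgeom : HasSum (fun i : ℕ => 1 / 4 * (1 / 4 : ℝ) ^ i) (1 / 3) := by
    have h := (hasSum_geometric_of_lt_one (r := (1 / 4 : ℝ)) (by norm_num) (by norm_num)).mul_left
      (1 / 4)
    rwa [show (1 / 4 : ℝ) * (1 - 1 / 4)⁻¹ = 1 / 3 by norm_num] at h
  have hsum : Summable fun i : ℕ => 1 / ((2 : ℝ) ^ (i + 1) + 1) ^ 2 :=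
    hgeom.summable.of_nonneg_of_le (fun i => by positivity) one_div_two_pow_succ_add_one_sq_le
  have htail : ∑' i : ℕ, 1 / ((2 : ℝ) ^ (i + 1 + 1) + 1) ^ 2 ≤
      ∑' i : ℕ, 1 / 4 * (1 / 4 : ℝ) ^ (i + 1) :=
    ((summable_nat_add_iff 1).2 hsum).tsum_le_tsum
      (fun i => one_div_two_pow_succ_add_one_sq_le (i + 1))
      ((summable_nat_add_iff 1).2 hgeom.summable)
  have hgeom_split := hgeom.summable.tsum_eq_zero_add
  rw [hgeom.tsum_eq] at hgeom_split
  rw [hsum.tsum_eq_zero_add]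
  norm_num at hgeom_split htail ⊢
  linarith
end

section
/- Let μ be a non-atomic Borel probability measure on [0,1] whose distribution function F_{m,0}(x) = μ([0,x]) is twice continuously differentiable on [0,1]. Define F_{m,n}(x) = μ({t : τ_mⁿ(t) ≤ x}) and f_{m,n}(x) = (1+(m−1)x)(m+(m−1)x)·F_{m,n}′(x). Then there exist constants q ∈ (0,1) and C > 0 such that |f_{m,n}′(x)| ≤ C·qⁿ for all n ∈ ℕ and x ∈ [0,1]. -/
open MeasureTheory Set

/-- Termwise differentiation of a series on a convex set. -/
theorem hasDerivWithinAt_tsum_of_convex {g g' : ℕ → ℝ → ℝ} {s : Set ℝ} (hs : Convex ℝ s)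
    {b : ℕ → ℝ} (hb : Summable b)
    (hg : ∀ i, ∀ x ∈ s, HasDerivWithinAt (g i) (g' i x) s x)
    (hbd : ∀ i, ∀ x ∈ s, |g' i x| ≤ b i) (hsum : ∀ x ∈ s, Summable fun i => g i x)
    {x : ℝ} (hx : x ∈ s) :
    HasDerivWithinAt (fun y => ∑' i, g i y) (∑' i, g' i x) s x := by
  rw [hasDerivWithinAt_iff_tendsto_slope]
  have key : Filter.Tendsto (fun y => ∑' i, slope (g i) x y) (nhdsWithin x (s \ {x}))
      (nhds (∑' i, g' i x)) := by
    refine tendsto_tsum_of_dominated_convergence hb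
      (fun i => hasDerivWithinAt_iff_tendsto_slope.1 (hg i x hx)) ?_
    filter_upwards [self_mem_nhdsWithin] with y hy i
    have h := hs.norm_image_sub_le_of_norm_hasDerivWithin_le (hg i)
      (fun z hz => hbd i z hz) hx hy.1
    have hne : 0 < ‖y - x‖ := norm_pos_iff.2 (sub_ne_zero.2 hy.2)
    rw [slope_def_field, norm_div, div_le_iff₀ hne]
    exact h
  refine key.congr' ?_
  filter_upwards [self_mem_nhdsWithin] with y hy
  simp only [slope_def_field]
  rw [tsum_div_const, (hsum y hy.1).tsum_sub (hsum x hx)]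

theorem abs_tsum_le_of_abs_le {g u : ℕ → ℝ} {a : ℝ} (hu : HasSum u a) (h : ∀ i, |g i| ≤ u i) :
    |∑' i, g i| ≤ a := by
  rw [← Real.norm_eq_abs]
  exact tsum_of_norm_bounded hu h

namespace Chan

/-- The denominator `1 + (b - 1) x` of the inverse branches of the Chan map. -/
noncomputable def den (b x : ℝ) : ℝ := 1 + (b - 1) * x

/-- The `i`-th inverse branch of the Chan map. -/
noncomputable def branch (b : ℝ) (i : ℕ) (x : ℝ) : ℝ := b⁻¹ ^ i / den b x

/-- The total weight of the first `i` inverse branches. -/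
noncomputable def cumWeight (b : ℝ) (i : ℕ) (x : ℝ) : ℝ :=
  den b x * (1 - b⁻¹ ^ i) / (den b x + (b - 1) * b⁻¹ ^ i)

/-- The weight of the `i`-th inverse branch. -/
noncomputable def weight (b : ℝ) (i : ℕ) (x : ℝ) : ℝ := cumWeight b (i + 1) x - cumWeight b i x

/-- The transfer operator of the Chan map, normalized by its invariant density. -/
noncomputable def transfer (b : ℝ) (f : ℝ → ℝ) (x : ℝ) : ℝ :=
  ∑' i, weight b i x * f (branch b i x)

variable {b x : ℝ}

theorem one_le_den (hb : 2 ≤ b) (hx : x ∈ Icc (0 : ℝ) 1) : 1 ≤ den b x := by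
  have := mul_nonneg (by linarith : 0 ≤ b - 1) hx.1
  unfold den; linarith

theorem den_le (hb : 2 ≤ b) (hx : x ∈ Icc (0 : ℝ) 1) : den b x ≤ b := by
  have := mul_le_mul_of_nonneg_left hx.2 (by linarith : 0 ≤ b - 1)
  unfold den; linarith

theorem inv_pow_pos (hb : 2 ≤ b) (i : ℕ) : 0 < b⁻¹ ^ i := by positivity

theorem inv_pow_le_one (hb : 2 ≤ b) (i : ℕ) : b⁻¹ ^ i ≤ 1 :=
  pow_le_one₀ (by positivity) (inv_le_one_of_one_le₀ (by linarith))

theorem inv_lt_one (hb : 2 ≤ b) : b⁻¹ < 1 := inv_lt_one_of_one_lt₀ (by linarith)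

theorem summable_inv_pow (hb : 2 ≤ b) : Summable fun i : ℕ => b⁻¹ ^ i :=
  summable_geometric_of_lt_one (by positivity) (inv_lt_one hb)

theorem branch_mem (hb : 2 ≤ b) (i : ℕ) (hx : x ∈ Icc (0 : ℝ) 1) :
    branch b i x ∈ Icc (0 : ℝ) 1 := by
  have hD := one_le_den hb hx
  have := inv_pow_pos hb i
  refine ⟨by unfold branch; positivity, ?_⟩
  rw [branch, div_le_one (by linarith)]
  exact (inv_pow_le_one hb i).trans hD

theorem hasDerivAt_den (b x : ℝ) : HasDerivAt (den b) (b - 1) x := by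
  unfold den
  simpa using ((hasDerivAt_id x).const_mul (b - 1)).const_add 1

theorem hasDerivAt_branch (hb : 2 ≤ b) (i : ℕ) (hx : x ∈ Icc (0 : ℝ) 1) :
    HasDerivAt (branch b i) (-(b⁻¹ ^ i * (b - 1) / den b x ^ 2)) x := by
  have hD := one_le_den hb hx
  have h := (hasDerivAt_const x (b⁻¹ ^ i)).div (hasDerivAt_den b x) (by linarith)
  exact h.congr_deriv (by ring)

theorem hasDerivAt_cumWeight (hb : 2 ≤ b) (i : ℕ) (hx : x ∈ Icc (0 : ℝ) 1) :
    HasDerivAt (cumWeight b i)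
      ((b - 1) ^ 2 * (1 - b⁻¹ ^ i) * b⁻¹ ^ i / (den b x + (b - 1) * b⁻¹ ^ i) ^ 2) x := by
  have hD := one_le_den hb hx
  have hp := mul_pos (by linarith : 0 < b - 1) (inv_pow_pos hb i)
  have h := ((hasDerivAt_den b x).mul_const (1 - b⁻¹ ^ i)).div
    ((hasDerivAt_den b x).add_const ((b - 1) * b⁻¹ ^ i)) (by linarith)
  exact h.congr_deriv (by ring)

theorem abs_cumWeight_deriv_le (hb : 2 ≤ b) (i : ℕ) (hx : x ∈ Icc (0 : ℝ) 1) :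
    |(b - 1) ^ 2 * (1 - b⁻¹ ^ i) * b⁻¹ ^ i / (den b x + (b - 1) * b⁻¹ ^ i) ^ 2|
      ≤ b ^ 2 * b⁻¹ ^ i := by
  have hD := one_le_den hb hx
  have h0 := inv_pow_pos hb i
  have h1 := inv_pow_le_one hb i
  have hp := mul_pos (by linarith : 0 < b - 1) h0
  have h2 : 0 ≤ 1 - b⁻¹ ^ i := by linarith
  rw [abs_of_nonneg (by positivity)]
  refine (div_le_self (by positivity) (one_le_pow₀ (by linarith))).trans ?_
  refine mul_le_mul_of_nonneg_right ?_ h0.le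
  nlinarith [sq_nonneg (b - 1)]

theorem hasDerivAt_weight (hb : 2 ≤ b) (i : ℕ) (hx : x ∈ Icc (0 : ℝ) 1) :
    ∃ w, HasDerivAt (weight b i) w x ∧ |w| ≤ 2 * b ^ 2 * b⁻¹ ^ i := by
  refine ⟨_, (hasDerivAt_cumWeight hb (i + 1) hx).sub (hasDerivAt_cumWeight hb i hx), ?_⟩
  have h1 := abs_cumWeight_deriv_le hb (i + 1) hx
  have h2 := abs_cumWeight_deriv_le hb i hx
  have h3 : b⁻¹ ^ (i + 1) ≤ b⁻¹ ^ i :=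
    pow_le_pow_of_le_one (by positivity) (inv_lt_one hb).le (Nat.le_succ i)
  have h4 := mul_le_mul_of_nonneg_left h3 (sq_nonneg b)
  refine (abs_sub _ _).trans ?_
  linarith

theorem weight_eq (hb : 2 ≤ b) (i : ℕ) (hx : x ∈ Icc (0 : ℝ) 1) :
    weight b i x = den b x * (b + (b - 1) * x) *
      (b⁻¹ ^ i * (b - 1) / den b x ^ 2 *
        (1 / (den b (branch b i x) * (b + (b - 1) * branch b i x)))) := by
  have hD := one_le_den hb hx
  have h0 := inv_pow_pos hb i
  have hb1 : 0 < b - 1 := by linarith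
  have hx' : b + (b - 1) * x = den b x + (b - 1) := by unfold den; ring
  rw [hx']
  simp only [weight, cumWeight, branch]
  rw [show den b (b⁻¹ ^ i / den b x) = 1 + (b - 1) * (b⁻¹ ^ i / den b x) from rfl, pow_succ]
  generalize den b x = D at *
  generalize b⁻¹ ^ i = e at *
  have : 0 < D := by linarith
  have : 0 < b := by linarith
  have h1 : D + (b - 1) * e ≠ 0 := by positivity
  have h2 : D + (b - 1) * (e * b⁻¹) ≠ 0 := by positivity
  have h3 : 1 + (b - 1) * (e / D) ≠ 0 := by positivity
  have h4 : b + (b - 1) * (e / D) ≠ 0 := by positivity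
  have h5 : D * b + (b - 1) * e ≠ 0 := by positivity
  field_simp
  ring

theorem weight_nonneg (hb : 2 ≤ b) (i : ℕ) (hx : x ∈ Icc (0 : ℝ) 1) : 0 ≤ weight b i x := by
  rw [weight_eq hb i hx]
  have hD := one_le_den hb hx
  have hu := branch_mem hb i hx
  have hD' := one_le_den hb hu
  have h0 := inv_pow_pos hb i
  have hb1 : 0 < b - 1 := by linarith
  have := hx.1
  have := hu.1
  positivity

theorem hasSum_weight (hb : 2 ≤ b) (hx : x ∈ Icc (0 : ℝ) 1) :
    HasSum (fun i => weight b i x) 1 := by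
  rw [hasSum_iff_tendsto_nat_of_nonneg (fun i => weight_nonneg hb i hx)]
  have hD := one_le_den hb hx
  have h0 : Filter.Tendsto (fun n : ℕ => b⁻¹ ^ n) Filter.atTop (nhds 0) :=
    tendsto_pow_atTop_nhds_zero_of_lt_one (by positivity) (inv_lt_one hb)
  have h : Filter.Tendsto (fun n => cumWeight b n x) Filter.atTop
      (nhds (den b x * (1 - 0) / (den b x + (b - 1) * 0))) :=
    ((h0.const_sub 1).const_mul _).div ((h0.const_mul (b - 1)).const_add _) (by linarith)
  have h1 : den b x * (1 - 0) / (den b x + (b - 1) * 0) = 1 := by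
    simp only [sub_zero, mul_one, mul_zero, add_zero]
    exact div_self (by linarith)
  rw [h1] at h
  refine h.congr fun n => ?_
  simp only [weight]
  rw [Finset.sum_range_sub (fun i => cumWeight b i x)]
  simp [cumWeight]

theorem weight_zero_ge (hb : 2 ≤ b) (hx : x ∈ Icc (0 : ℝ) 1) : 1 / 3 ≤ weight b 0 x := by
  have hD := one_le_den hb hx
  have hb1 : 0 < b - 1 := by linarith
  have hb0 : 0 < b := by linarith
  simp only [weight, cumWeight, zero_add, pow_one, pow_zero, sub_self, mul_zero, zero_div, sub_zero]
  generalize den b x = D at *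
  rw [div_le_div_iff₀ (by norm_num) (by positivity)]
  have : b * b⁻¹ = 1 := mul_inv_cancel₀ hb0.ne'
  have h2 : 0 < b⁻¹ := by positivity
  have h3 : b⁻¹ ≤ 1 / 2 := by
    rw [inv_le_comm₀ hb0 (by norm_num)]; norm_num; exact hb
  nlinarith

theorem weight_le (hb : 2 ≤ b) (i : ℕ) (hx : x ∈ Icc (0 : ℝ) 1) :
    weight b i x ≤ 1 :=
  le_hasSum (hasSum_weight hb hx) i fun j _ => weight_nonneg hb j hx

variable {f : ℝ → ℝ}

theorem summable_weight_mul (hb : 2 ≤ b) {O : ℝ} (hf : ∀ y ∈ Icc (0 : ℝ) 1, |f y| ≤ O)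
    (hx : x ∈ Icc (0 : ℝ) 1) : Summable fun i => weight b i x * f (branch b i x) := by
  refine Summable.of_norm_bounded ((hasSum_weight hb hx).summable.mul_right O) fun i => ?_
  rw [norm_mul, Real.norm_of_nonneg (weight_nonneg hb i hx)]
  exact mul_le_mul_of_nonneg_left (hf _ (branch_mem hb i hx)) (weight_nonneg hb i hx)

theorem transfer_sub_const (hb : 2 ≤ b) {O c : ℝ} (hf : ∀ y ∈ Icc (0 : ℝ) 1, |f y - c| ≤ O)
    (hx : x ∈ Icc (0 : ℝ) 1) : transfer b (fun y => f y - c) x = transfer b f x - c := by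
  have h1 : Summable fun i => weight b i x * (f (branch b i x) - c) :=
    summable_weight_mul (f := fun y => f y - c) hb hf hx
  have h := h1.hasSum.add ((hasSum_weight hb hx).mul_right c)
  have h2 : transfer b f x = transfer b (fun y => f y - c) x + 1 * c := by
    refine HasSum.tsum_eq (h.congr_fun ?_)
    intro i; ring
  linarith

/-- The weight of the zeroth branch being at least `1 / 3`, the other branches contribute at most
two thirds of the supremum. -/
theorem abs_transfer_sub_le (hb : 2 ≤ b) {O : ℝ} (hf : ∀ y ∈ Icc (0 : ℝ) 1, |f y| ≤ O)
    (hx : x ∈ Icc (0 : ℝ) 1) :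
    |transfer b f x - 1 / 3 * f (branch b 0 x)| ≤ (1 - 1 / 3) * O := by
  have hs := summable_weight_mul hb hf hx
  have hw := hasSum_weight hb hx
  have h1 : transfer b f x = weight b 0 x * f (branch b 0 x) +
      ∑' i, weight b (i + 1) x * f (branch b (i + 1) x) := hs.tsum_eq_zero_add
  have h2 : (1 : ℝ) = weight b 0 x + ∑' i, weight b (i + 1) x := by
    rw [← hw.tsum_eq]; exact hw.summable.tsum_eq_zero_add
  have h3 : |∑' i, weight b (i + 1) x * f (branch b (i + 1) x)| ≤
      ∑' i, weight b (i + 1) x * O := by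
    refine abs_tsum_le_of_abs_le (((summable_nat_add_iff 1).2 hw.summable).mul_right O).hasSum
      fun i => ?_
    rw [abs_mul, abs_of_nonneg (weight_nonneg hb _ hx)]
    exact mul_le_mul_of_nonneg_left (hf _ (branch_mem hb _ hx)) (weight_nonneg hb _ hx)
  rw [tsum_mul_right] at h3
  have h4 := hf _ (branch_mem hb 0 hx)
  have h5 := weight_zero_ge hb hx
  rw [h1, show weight b 0 x * f (branch b 0 x) +
      ∑' i, weight b (i + 1) x * f (branch b (i + 1) x) - 1 / 3 * f (branch b 0 x) =
      (weight b 0 x - 1 / 3) * f (branch b 0 x) +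
      ∑' i, weight b (i + 1) x * f (branch b (i + 1) x) by ring]
  refine (abs_add_le _ _).trans ?_
  rw [abs_mul, abs_of_nonneg (by linarith : 0 ≤ weight b 0 x - 1 / 3)]
  have h6 := mul_le_mul_of_nonneg_left h4 (by linarith : 0 ≤ weight b 0 x - 1 / 3)
  have h7 : (1 - 1 / 3) * O = (weight b 0 x - 1 / 3) * O + (∑' i, weight b (i + 1) x) * O := by
    rw [← add_mul]; congr 1; linarith
  linarith

theorem abs_transfer_le (hb : 2 ≤ b) {O : ℝ} (hf : ∀ y ∈ Icc (0 : ℝ) 1, |f y| ≤ O)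
    (hx : x ∈ Icc (0 : ℝ) 1) : |transfer b f x| ≤ O := by
  have h := abs_transfer_sub_le hb hf hx
  have h' := hf _ (branch_mem hb 0 hx)
  rw [abs_le] at *
  constructor <;> linarith

theorem abs_iterate_transfer_le (hb : 2 ≤ b) {O : ℝ} (hf : ∀ y ∈ Icc (0 : ℝ) 1, |f y| ≤ O)
    (k : ℕ) : ∀ y ∈ Icc (0 : ℝ) 1, |(transfer b)^[k] f y| ≤ O := by
  induction k with
  | zero => exact hf
  | succ k ih =>
    intro y hy
    rw [Function.iterate_succ_apply']
    exact abs_transfer_le hb ih hy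

theorem abs_iterate_transfer_sub_le (hb : 2 ≤ b) {O : ℝ}
    (hf : ∀ y ∈ Icc (0 : ℝ) 1, |f y| ≤ O) (k : ℕ) : ∀ x ∈ Icc (0 : ℝ) 1,
    |(transfer b)^[k] f x - (1 / 3) ^ k * f ((branch b 0)^[k] x)| ≤ (1 - (1 / 3) ^ k) * O := by
  induction k with
  | zero => simp
  | succ k ih =>
    intro x hx
    rw [Function.iterate_succ_apply', Function.iterate_succ_apply]
    have h1 := abs_transfer_sub_le hb (abs_iterate_transfer_le hb hf k) hx
    have h2 := ih _ (branch_mem hb 0 hx)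
    rw [pow_succ]
    rw [abs_le] at *
    constructor <;> linarith

/-- `f` is differentiable on the unit interval and its derivative with respect to `log (den b)`
is bounded by a multiple of `K`. -/
def DerivBound (b K : ℝ) (f : ℝ → ℝ) : Prop :=
  ∀ x ∈ Icc (0 : ℝ) 1, ∃ v, HasDerivWithinAt f v (Icc 0 1) x ∧ den b x * |v| ≤ K

theorem den_mul_branch_deriv (hb : 2 ≤ b) (i : ℕ) (hx : x ∈ Icc (0 : ℝ) 1) {v K : ℝ}
    (hv : den b (branch b i x) * |v| ≤ K) :
    den b x * |v * -(b⁻¹ ^ i * (b - 1) / den b x ^ 2)| ≤ (1 - b⁻¹) * K := by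
  have hD := one_le_den hb hx
  have h0 := inv_pow_pos hb i
  have hb1 : 0 < b - 1 := by linarith
  have hb0 : 0 < b := by linarith
  have hu := branch_mem hb i hx
  have hp : 0 ≤ b⁻¹ ^ i * (b - 1) / den b x ^ 2 := by positivity
  rw [abs_mul, abs_neg, abs_of_nonneg hp]
  have e : den b x * (|v| * (b⁻¹ ^ i * (b - 1) / den b x ^ 2)) =
      (b - 1) * branch b i x * |v| := by
    unfold branch; field_simp
  have h1 : (b - 1) * branch b i x ≤ (1 - b⁻¹) * den b (branch b i x) := by
    have h2 := mul_le_mul_of_nonneg_left (den_le hb hu) (by positivity : 0 ≤ b⁻¹)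
    rw [inv_mul_cancel₀ hb0.ne'] at h2
    have h3 : (b - 1) * branch b i x = den b (branch b i x) - 1 := by unfold den; ring
    linarith
  rw [e]
  calc (b - 1) * branch b i x * |v| ≤ (1 - b⁻¹) * den b (branch b i x) * |v| :=
        mul_le_mul_of_nonneg_right h1 (abs_nonneg _)
    _ = (1 - b⁻¹) * (den b (branch b i x) * |v|) := by ring
    _ ≤ _ := mul_le_mul_of_nonneg_left hv (by linarith [inv_lt_one hb])

theorem mapsTo_branch (hb : 2 ≤ b) (i : ℕ) :
    MapsTo (branch b i) (Icc (0 : ℝ) 1) (Icc (0 : ℝ) 1) := fun _ hx => branch_mem hb i hx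

theorem DerivBound.comp_branch {K : ℝ} (hb : 2 ≤ b) (hf : DerivBound b K f) :
    DerivBound b ((1 - b⁻¹) * K) (f ∘ branch b 0) := by
  intro x hx
  obtain ⟨v, hv, hvK⟩ := hf _ (branch_mem hb 0 hx)
  exact ⟨_, hv.comp x (hasDerivAt_branch hb 0 hx).hasDerivWithinAt (mapsTo_branch hb 0),
    den_mul_branch_deriv hb 0 hx hvK⟩

theorem DerivBound.comp_iterate_branch {K : ℝ} (hb : 2 ≤ b) (hf : DerivBound b K f) (k : ℕ) :
    DerivBound b ((1 - b⁻¹) ^ k * K) (f ∘ (branch b 0)^[k]) := by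
  induction k with
  | zero => simpa using hf
  | succ k ih =>
    rw [Function.iterate_succ, pow_succ', mul_assoc]
    exact ih.comp_branch hb

theorem DerivBound.abs_sub_le {K y : ℝ} (hb : 2 ≤ b) (hf : DerivBound b K f)
    (hx : x ∈ Icc (0 : ℝ) 1) (hy : y ∈ Icc (0 : ℝ) 1) : |f x - f y| ≤ K := by
  choose! v hv hvK using hf
  have hbd : ∀ z ∈ Icc (0 : ℝ) 1, ‖v z‖ ≤ K := fun z hz =>
    (le_mul_of_one_le_left (abs_nonneg _) (one_le_den hb hz)).trans (hvK z hz)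
  have hK : 0 ≤ K := (norm_nonneg _).trans (hbd x hx)
  have h := (convex_Icc (0 : ℝ) 1).norm_image_sub_le_of_norm_hasDerivWithin_le hv hbd hy hx
  refine h.trans (mul_le_of_le_one_right hK ?_)
  rw [Real.norm_eq_abs, abs_le]
  constructor <;> linarith [hx.1, hx.2, hy.1, hy.2]

theorem DerivBound.mono {K K' : ℝ} (hf : DerivBound b K f) (h : K ≤ K') : DerivBound b K' f :=
  fun x hx => (hf x hx).imp fun _ hv => ⟨hv.1, hv.2.trans h⟩

theorem DerivBound.sub_const {K : ℝ} (hf : DerivBound b K f) (c : ℝ) :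
    DerivBound b K fun y => f y - c :=
  fun x hx => (hf x hx).imp fun _ hv => ⟨hv.1.sub_const c, hv.2⟩

/-- The transfer operator preserves differentiability, and contracts the derivative up to a
multiple of the supremum. -/
theorem DerivBound.transfer_of_abs_le {K O : ℝ} (hb : 2 ≤ b) (hf : DerivBound b K f)
    (hO : ∀ y ∈ Icc (0 : ℝ) 1, |f y| ≤ O) :
    DerivBound b ((1 - b⁻¹) * K + 4 * b ^ 3 * O) (transfer b f) := by
  have hb0 : 0 < b := by linarith
  have hθ : 0 < 1 - b⁻¹ := by linarith [inv_lt_one hb]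
  choose! v hv hvK using hf
  have hw := fun (i : ℕ) (x : ℝ) (hx : x ∈ Icc (0 : ℝ) 1) => hasDerivAt_weight hb i hx
  choose! w hw hwb using hw
  have hK : 0 ≤ K := (mul_nonneg (by linarith [one_le_den hb (left_mem_Icc.2 zero_le_one)])
    (abs_nonneg _)).trans (hvK 0 (left_mem_Icc.2 zero_le_one))
  have hO0 : 0 ≤ O := (abs_nonneg _).trans (hO 0 (left_mem_Icc.2 zero_le_one))
  set A : ℕ → ℝ → ℝ := fun i x => w i x * f (branch b i x) with hA
  set B : ℕ → ℝ → ℝ := fun i x =>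
    weight b i x * (v (branch b i x) * -(b⁻¹ ^ i * (b - 1) / den b x ^ 2)) with hB
  have hAb : ∀ i, ∀ x ∈ Icc (0 : ℝ) 1, |A i x| ≤ 2 * b ^ 2 * b⁻¹ ^ i * O := by
    intro i x hx
    rw [hA, abs_mul]
    exact mul_le_mul (hwb i x hx) (hO _ (branch_mem hb i hx)) (abs_nonneg _) (by positivity)
  have hBb : ∀ i, ∀ x ∈ Icc (0 : ℝ) 1, |B i x| ≤ b * K * b⁻¹ ^ i := by
    intro i x hx
    have hD := one_le_den hb hx
    have hu := branch_mem hb i hx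
    have h0 := inv_pow_pos hb i
    have h1 : |v (branch b i x)| ≤ K :=
      (le_mul_of_one_le_left (abs_nonneg _) (one_le_den hb hu)).trans (hvK _ hu)
    have h2 : b⁻¹ ^ i * (b - 1) / den b x ^ 2 ≤ b⁻¹ ^ i * b := by
      refine (div_le_self ?_ (one_le_pow₀ hD)).trans ?_
      · exact mul_nonneg h0.le (by linarith)
      · exact mul_le_mul_of_nonneg_left (by linarith) h0.le
    have h3 : 0 ≤ b⁻¹ ^ i * (b - 1) / den b x ^ 2 :=
      div_nonneg (mul_nonneg h0.le (by linarith)) (sq_nonneg _)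
    rw [hB, abs_mul, abs_of_nonneg (weight_nonneg hb i hx)]
    refine (mul_le_of_le_one_left (abs_nonneg _) (weight_le hb i hx)).trans ?_
    rw [abs_mul, abs_neg, abs_of_nonneg h3]
    calc _ ≤ K * (b⁻¹ ^ i * b) := mul_le_mul h1 h2 h3 hK
      _ = _ := by ring
  have sA : Summable fun i : ℕ => 2 * b ^ 2 * b⁻¹ ^ i * O :=
    ((summable_inv_pow hb).mul_left _).mul_right _
  have sB : Summable fun i : ℕ => b * K * b⁻¹ ^ i := (summable_inv_pow hb).mul_left _
  intro x hx
  have hD := one_le_den hb hx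
  refine ⟨∑' i, (A i x + B i x), ?_, ?_⟩
  · refine hasDerivWithinAt_tsum_of_convex (convex_Icc 0 1) (sA.add sB)
      (g' := fun i x => A i x + B i x) ?_ ?_ (fun y hy => summable_weight_mul hb hO hy) hx
    · intro i y hy
      exact (hw i y hy).hasDerivWithinAt.mul
        ((hv _ (branch_mem hb i hy)).comp y (hasDerivAt_branch hb i hy).hasDerivWithinAt
          (mapsTo_branch hb i))
    · exact fun i y hy => (abs_add_le _ _).trans (add_le_add (hAb i y hy) (hBb i y hy))
  · have sA' : Summable fun i => A i x := Summable.of_norm_bounded sA fun i => hAb i x hx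
    have sB' : Summable fun i => B i x := Summable.of_norm_bounded sB fun i => hBb i x hx
    rw [sA'.tsum_add sB']
    have h1 : |∑' i, A i x| ≤ 4 * b ^ 2 * O := by
      have h := abs_tsum_le_of_abs_le sA.hasSum fun i => hAb i x hx
      rw [tsum_mul_right, tsum_mul_left, tsum_geometric_of_lt_one (by positivity) (inv_lt_one hb)]
        at h
      refine h.trans (mul_le_mul_of_nonneg_right ?_ hO0)
      have : (1 - b⁻¹)⁻¹ ≤ 2 := by
        rw [inv_le_comm₀ hθ (by norm_num)]
        have := inv_anti₀ (by norm_num) hb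
        norm_num at this ⊢
        linarith
      nlinarith [sq_nonneg b]
    have h2 : den b x * |∑' i, B i x| ≤ (1 - b⁻¹) * K := by
      rw [← abs_of_nonneg (by linarith : 0 ≤ den b x), ← abs_mul, ← tsum_mul_left]
      have hs := (hasSum_weight hb hx).mul_right ((1 - b⁻¹) * K)
      rw [one_mul] at hs
      refine abs_tsum_le_of_abs_le hs fun i => ?_
      have hwn := weight_nonneg hb i hx
      have h := den_mul_branch_deriv hb i hx (hvK _ (branch_mem hb i hx))
      rw [hB, abs_mul, abs_mul,
        abs_of_nonneg (by linarith : 0 ≤ den b x), abs_of_nonneg hwn]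
      calc _ = weight b i x * (den b x *
            |v (branch b i x) * -(b⁻¹ ^ i * (b - 1) / den b x ^ 2)|) := by ring
        _ ≤ _ := mul_le_mul_of_nonneg_left h hwn
    have h3 : den b x * |∑' i, A i x| ≤ 4 * b ^ 3 * O :=
      calc _ ≤ b * (4 * b ^ 2 * O) := mul_le_mul (den_le hb hx) h1 (abs_nonneg _) hb0.le
        _ = _ := by ring
    calc _ ≤ den b x * (|∑' i, A i x| + |∑' i, B i x|) :=
          mul_le_mul_of_nonneg_left (abs_add_le _ _) (by linarith)
      _ ≤ _ := by rw [mul_add]; linarith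

/-- `f` is within `O` of a constant and satisfies `DerivBound b K f`. -/
def Controlled (b O K : ℝ) (f : ℝ → ℝ) : Prop :=
  (∃ c, ∀ y ∈ Icc (0 : ℝ) 1, |f y - c| ≤ O) ∧ DerivBound b K f

theorem DerivBound.congr {K : ℝ} {g : ℝ → ℝ} (hf : DerivBound b K f)
    (h : ∀ x ∈ Icc (0 : ℝ) 1, g x = f x) : DerivBound b K g :=
  fun x hx => (hf x hx).imp fun _ hv => ⟨hv.1.congr_of_mem h hx, hv.2⟩

theorem iterate_transfer_sub_const (hb : 2 ≤ b) {O c : ℝ}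
    (hf : ∀ y ∈ Icc (0 : ℝ) 1, |f y - c| ≤ O) (k : ℕ) : ∀ x ∈ Icc (0 : ℝ) 1,
    (transfer b)^[k] (fun y => f y - c) x = (transfer b)^[k] f x - c := by
  induction k with
  | zero => simp
  | succ k ih =>
    intro x hx
    have h : ∀ y ∈ Icc (0 : ℝ) 1, |(transfer b)^[k] f y - c| ≤ O := fun y hy => by
      rw [← ih y hy]
      exact abs_iterate_transfer_le (f := fun y => f y - c) hb hf k y hy
    rw [Function.iterate_succ_apply', Function.iterate_succ_apply', ← transfer_sub_const hb h hx]
    exact tsum_congr fun i => by rw [ih _ (branch_mem hb i hx)]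

theorem Controlled.transfer {O K : ℝ} (hb : 2 ≤ b) (hf : Controlled b O K f) :
    Controlled b O ((1 - b⁻¹) * K + 4 * b ^ 3 * O) (transfer b f) := by
  obtain ⟨⟨c, hc⟩, hK⟩ := hf
  refine ⟨⟨c, fun y hy => ?_⟩, ?_⟩
  · rw [← transfer_sub_const hb hc hy]
    exact abs_transfer_le (f := fun y => f y - c) hb hc hy
  · have h := (hK.sub_const c).transfer_of_abs_le hb hc
    have h' : DerivBound b ((1 - b⁻¹) * K + 4 * b ^ 3 * O) fun y => Chan.transfer b f y - c :=
      h.congr fun x hx => (transfer_sub_const hb hc hx).symm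
    simpa using h'.sub_const (-c)

theorem Controlled.iterate_transfer {O K : ℝ} (hb : 2 ≤ b) (hf : Controlled b O K f) (k : ℕ) :
    Controlled b O ((1 - b⁻¹) ^ k * K + 4 * b ^ 4 * O) ((Chan.transfer b)^[k] f) := by
  have hO : 0 ≤ O := by
    obtain ⟨⟨c, hc⟩, -⟩ := hf
    exact (abs_nonneg _).trans (hc 0 (left_mem_Icc.2 zero_le_one))
  induction k with
  | zero =>
    refine ⟨hf.1, hf.2.mono ?_⟩
    rw [pow_zero, one_mul]
    exact le_add_of_nonneg_right (by positivity)
  | succ k ih =>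
    rw [Function.iterate_succ_apply']
    refine ⟨(ih.transfer hb).1, (ih.transfer hb).2.mono (le_of_eq ?_)⟩
    have hb' : b ^ 4 * b⁻¹ = b ^ 3 := by
      rw [pow_succ b 3, mul_assoc, mul_inv_cancel₀ (by linarith), mul_one]
    rw [pow_succ']
    linear_combination (-4 * O) * hb'

theorem Controlled.iterate_transfer_center {O K : ℝ} (hb : 2 ≤ b) (hf : Controlled b O K f)
    (k : ℕ) : Controlled b ((1 - (1 / 3) ^ k) * O + (1 / 3) ^ k * ((1 - b⁻¹) ^ k * K))
      ((1 - b⁻¹) ^ k * K + 4 * b ^ 4 * O) ((Chan.transfer b)^[k] f) := by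
  refine ⟨?_, (hf.iterate_transfer hb k).2⟩
  obtain ⟨⟨c, hc⟩, hK⟩ := hf
  have h0 : (0 : ℝ) ∈ Icc (0 : ℝ) 1 := left_mem_Icc.2 zero_le_one
  refine ⟨c + (1 / 3) ^ k * (f ((branch b 0)^[k] 0) - c), fun y hy => ?_⟩
  have h1 := abs_iterate_transfer_sub_le (f := fun y => f y - c) hb hc k y hy
  rw [iterate_transfer_sub_const hb hc k y hy] at h1
  have h2 := (hK.comp_iterate_branch hb k).abs_sub_le hb hy h0
  have h3 := mul_le_mul_of_nonneg_left h2 (by positivity : (0 : ℝ) ≤ (1 / 3) ^ k)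
  rw [← abs_of_nonneg (by positivity : (0 : ℝ) ≤ (1 / 3) ^ k), ← abs_mul,
    abs_of_nonneg (by positivity : (0 : ℝ) ≤ (1 / 3) ^ k)] at h3
  simp only [Function.comp_apply] at h3
  refine le_trans (le_of_eq ?_) ((abs_add_le _ _).trans (add_le_add h1 h3))
  congr 1
  ring

/-- Iterating the transfer operator makes the derivative decay exponentially. -/
theorem DerivBound.exists_decay {K₀ : ℝ} (hb : 2 ≤ b) (hf : DerivBound b K₀ f) :
    ∃ q ∈ Ioo (0 : ℝ) 1, ∃ C > (0 : ℝ), ∀ n : ℕ,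
      DerivBound b (C * q ^ n) ((Chan.transfer b)^[n] f) := by
  have h0 : (0 : ℝ) ∈ Icc (0 : ℝ) 1 := left_mem_Icc.2 zero_le_one
  have hK₀ : 0 ≤ K₀ := (abs_nonneg _).trans (hf.abs_sub_le hb h0 h0)
  have hθ0 : 0 ≤ 1 - b⁻¹ := by linarith [inv_lt_one hb]
  have hθ1 : 1 - b⁻¹ < 1 := by
    have : 0 < b⁻¹ := by positivity
    linarith
  obtain ⟨M, hM⟩ : ∃ M, M = 4 * b ^ 4 := ⟨_, rfl⟩
  have hM0 : 0 < M := by rw [hM]; positivity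
  obtain ⟨k, hk⟩ := exists_pow_lt_of_lt_one (by positivity : 0 < 1 / (2 * (2 * M + 1))) hθ1
  have hη : (1 - b⁻¹) ^ k * (2 * M + 1) ≤ 1 / 2 := by
    rw [lt_div_iff₀ (by positivity)] at hk
    linarith
  have hk0 : 0 < k := by
    rcases Nat.eq_zero_or_pos k with rfl | h
    · rw [pow_zero] at hη; linarith
    · exact h
  have hη0 : 0 ≤ (1 - b⁻¹) ^ k := pow_nonneg hθ0 k
  have hstep := fun (O K : ℝ) (g : ℝ → ℝ) (hg : Controlled b O K g) =>
    hg.iterate_transfer_center hb k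
  rw [← hM] at hstep
  obtain ⟨ε, hε⟩ : ∃ ε : ℝ, ε = (1 / 3) ^ k := ⟨_, rfl⟩
  have hε0 : 0 < ε := by rw [hε]; positivity
  have hε1 : ε ≤ 1 := by rw [hε]; exact pow_le_one₀ (by norm_num) (by norm_num)
  rw [← hε] at hstep
  generalize (1 - b⁻¹) ^ k = η at *
  obtain ⟨a, ha⟩ : ∃ a, ε = 2 * M * a := ⟨ε / (2 * M), by field_simp⟩
  have ha0 : 0 < a := by
    rw [ha] at hε0
    exact pos_of_mul_pos_right hε0 (by positivity)
  set Q := 1 - ε / 2 with hQ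
  have hQ0 : 1 / 2 ≤ Q := by linarith
  set N := (1 + a) * K₀ with hN
  have hN0 : 0 ≤ N := by positivity
  have main : ∀ j : ℕ, ∃ O K, 0 ≤ O ∧ 0 ≤ K ∧ Controlled b O K ((Chan.transfer b)^[k * j] f) ∧
      O + a * K ≤ Q ^ j * N := by
    intro j
    induction j with
    | zero =>
      refine ⟨K₀, K₀, hK₀, hK₀, ⟨⟨f 0, fun y hy => hf.abs_sub_le hb hy h0⟩, hf⟩, ?_⟩
      rw [pow_zero, hN]; linarith
    | succ j ih =>
      obtain ⟨O, K, hO, hK, hc, hle⟩ := ih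
      have h := hstep _ _ _ hc
      rw [← Function.iterate_add_apply, add_comm k, ← Nat.mul_succ] at h
      have h1ε : 0 ≤ 1 - ε := by linarith
      refine ⟨_, _, by positivity, by positivity, h, ?_⟩
      have e1 : (1 - ε) * O + ε * (η * K) + a * (η * K + M * O) =
          Q * O + a * (η * (2 * M + 1)) * K := by
        rw [hQ, ha]; ring
      have e2 : a * (η * (2 * M + 1)) * K ≤ a * Q * K :=
        mul_le_mul_of_nonneg_right (mul_le_mul_of_nonneg_left (hη.trans hQ0) ha0.le) hK
      have e3 := mul_le_mul_of_nonneg_left hle (by linarith : 0 ≤ Q)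
      rw [e1, pow_succ']
      linarith
  set q := 1 - ε / 2 / k with hq
  have hk1 : (1 : ℝ) ≤ k := by exact_mod_cast hk0
  have hq0 : 0 < q := by
    have := div_le_self (by positivity : 0 ≤ ε / 2) hk1
    linarith
  have hq1 : q < 1 := by
    have : 0 < ε / 2 / k := by positivity
    linarith
  have hQq : Q ≤ q ^ k := by
    have h := one_add_mul_le_pow (by linarith : -2 ≤ q - 1) k
    rw [add_sub_cancel] at h
    refine le_trans (le_of_eq ?_) h
    rw [hq, hQ]
    field_simp
    ring
  refine ⟨q, ⟨hq0, hq1⟩, (1 / a + M) * N / q ^ k + 1, by positivity, fun n => ?_⟩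
  obtain ⟨O, K, hO, hK, hc, hle⟩ := main (n / k)
  have h := hc.iterate_transfer hb (n % k)
  rw [← Function.iterate_add_apply, Nat.mod_add_div, ← hM] at h
  refine h.2.mono ?_
  have e1 : (1 - b⁻¹) ^ (n % k) * K ≤ K := mul_le_of_le_one_left hK (pow_le_one₀ hθ0 hθ1.le)
  have e2 : K + M * O ≤ (1 / a + M) * (O + a * K) := by
    have : (1 / a + M) * (O + a * K) = K + M * O + (O / a + M * a * K) := by field_simp; ring
    rw [this]
    exact le_add_of_nonneg_right (by positivity)
  have e3 : Q ^ (n / k) ≤ q ^ n / q ^ k := by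
    rw [le_div_iff₀ (by positivity)]
    calc Q ^ (n / k) * q ^ k ≤ (q ^ k) ^ (n / k) * q ^ (n % k) :=
          mul_le_mul (pow_le_pow_left₀ (by linarith) hQq _)
            (pow_le_pow_of_le_one hq0.le hq1.le (Nat.mod_lt n hk0).le) (by positivity)
            (by positivity)
      _ = q ^ n := by rw [← pow_mul, ← pow_add, Nat.div_add_mod]
  calc (1 - b⁻¹) ^ (n % k) * K + M * O ≤ (1 / a + M) * (O + a * K) := by linarith
    _ ≤ (1 / a + M) * (q ^ n / q ^ k * N) := by
        refine mul_le_mul_of_nonneg_left (hle.trans ?_) (by positivity)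
        exact mul_le_mul_of_nonneg_right e3 hN0
    _ = (1 / a + M) * N / q ^ k * q ^ n := by ring
    _ ≤ _ := mul_le_mul_of_nonneg_right (by linarith) (by positivity)

/-- One step of the recurrence for the distribution functions, in terms of densities relative to
the invariant density. -/
theorem hasDerivWithinAt_of_hasSum {G H : ℝ → ℝ} {O : ℝ} (hb : 2 ≤ b)
    (hG : ∀ x ∈ Icc (0 : ℝ) 1,
      HasDerivWithinAt G (1 / (den b x * (b + (b - 1) * x)) * f x) (Icc 0 1) x)
    (hf : ∀ x ∈ Icc (0 : ℝ) 1, |f x| ≤ O)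
    (hH : ∀ x ∈ Icc (0 : ℝ) 1, HasSum (fun i => G (b⁻¹ ^ i) - G (branch b i x)) (H x)) :
    ∀ x ∈ Icc (0 : ℝ) 1,
      HasDerivWithinAt H (1 / (den b x * (b + (b - 1) * x)) * transfer b f x) (Icc 0 1) x := by
  intro x hx
  have hb1 : 0 < b - 1 := by linarith
  have hb0 : 0 < b := by linarith
  have hO : 0 ≤ O := (abs_nonneg _).trans (hf x hx)
  have h := hasDerivWithinAt_tsum_of_convex (convex_Icc (0 : ℝ) 1)
    (g := fun i x => G (b⁻¹ ^ i) - G (branch b i x))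
    (g' := fun i x => b⁻¹ ^ i * (b - 1) / den b x ^ 2 *
      (1 / (den b (branch b i x) * (b + (b - 1) * branch b i x)) * f (branch b i x)))
    (((summable_inv_pow hb).mul_right b).mul_right O) ?_ ?_ (fun y hy => (hH y hy).summable) hx
  · refine (h.congr_of_mem (fun y hy => (hH y hy).tsum_eq.symm) hx).congr_deriv ?_
    rw [transfer, ← tsum_mul_left]
    refine tsum_congr fun i => ?_
    have hD := one_le_den hb hx
    have := hx.1
    have h1 : b + (b - 1) * x ≠ 0 := by positivity
    have h2 : den b x ≠ 0 := by positivity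
    rw [weight_eq hb i hx]
    generalize 1 / (den b (branch b i x) * (b + (b - 1) * branch b i x)) = c
    field_simp
  · intro i y hy
    have h1 := ((hG _ (branch_mem hb i hy)).comp y (hasDerivAt_branch hb i hy).hasDerivWithinAt
      (mapsTo_branch hb i)).const_sub (G (b⁻¹ ^ i))
    exact h1.congr_deriv (by ring)
  · intro i y hy
    have hD := one_le_den hb hy
    have hu := branch_mem hb i hy
    have hu0 := hu.1
    have hDu := one_le_den hb hu
    have hp := inv_pow_pos hb i
    have h1 : b⁻¹ ^ i * (b - 1) / den b y ^ 2 ≤ b⁻¹ ^ i * b :=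
      (div_le_self (by positivity) (one_le_pow₀ hD)).trans
        (mul_le_mul_of_nonneg_left (by linarith) hp.le)
    have h2 : 1 / (den b (branch b i y) * (b + (b - 1) * branch b i y)) ≤ 1 := by
      rw [div_le_one (by positivity)]
      have := mul_nonneg hb1.le hu0
      exact one_le_mul_of_one_le_of_one_le hDu (by linarith)
    rw [abs_mul, abs_mul, abs_of_nonneg (by positivity), abs_of_nonneg (by positivity)]
    exact mul_le_mul h1 ((mul_le_of_le_one_left (abs_nonneg _) h2).trans (hf _ hu))
      (by positivity) (by positivity)

theorem measurable_chanTau (m : ℕ) : Measurable (chanTau m) := by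
  unfold chanTau
  refine Measurable.ite (measurableSet_singleton 0) measurable_const ?_
  have h1 : Measurable fun x : ℝ => ⌊-Real.logb m x⌋ := by
    unfold Real.logb
    exact ((Real.measurable_log.div_const _).neg).floor
  have h2 : Measurable fun x : ℝ => (m : ℝ) ^ ⌊-Real.logb m x⌋ :=
    (measurable_of_countable fun z : ℤ => (m : ℝ) ^ z).comp h1
  exact (((h2.mul measurable_id).const_div 1).sub_const 1).const_mul _

theorem chanTau_of_mem {m : ℕ} (hm : 2 ≤ m) {i : ℕ} {s : ℝ}
    (hs : s ∈ Ioc ((m : ℝ)⁻¹ ^ (i + 1)) ((m : ℝ)⁻¹ ^ i)) :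
    chanTau m s = (1 / ((m : ℝ) - 1)) * ((m : ℝ)⁻¹ ^ i / s - 1) := by
  have hm' : (2 : ℝ) ≤ m := by exact_mod_cast hm
  have hs0 : 0 < s := (inv_pow_pos hm' _).trans hs.1
  have hfl : ⌊-Real.logb m s⌋ = (i : ℤ) := by
    rw [Int.floor_eq_iff]
    have e (j : ℕ) : (m : ℝ)⁻¹ ^ j = (m : ℝ) ^ (-(j : ℝ)) := by
      rw [Real.rpow_neg (by positivity), Real.rpow_natCast, inv_pow]
    have h1 := (Real.logb_le_iff_le_rpow (by linarith : (1 : ℝ) < m) hs0).2 (hs.2.trans_eq (e i))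
    have h2 := (Real.lt_logb_iff_rpow_lt (by linarith : (1 : ℝ) < m) hs0).2
      ((e (i + 1)).symm.trans_lt hs.1)
    push_cast at h2 ⊢
    constructor <;> linarith
  rw [chanTau, if_neg hs0.ne', hfl, zpow_natCast, inv_pow]
  field_simp

theorem countable_preimage_chanTau {m : ℕ} (hm : 2 ≤ m) (y : ℝ) :
    (chanTau m ⁻¹' {y}).Countable := by
  have hm' : (2 : ℝ) ≤ m := by exact_mod_cast hm
  refine ((countable_singleton (0 : ℝ)).union
    (countable_range fun z : ℤ => 1 / ((m : ℝ) ^ z * (1 + ((m : ℝ) - 1) * y)))).mono ?_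
  intro s hs
  by_cases h0 : s = 0
  · exact Or.inl h0
  refine Or.inr ⟨⌊-Real.logb m s⌋, ?_⟩
  have hy : chanTau m s = y := hs
  rw [chanTau, if_neg h0] at hy
  have hz : (m : ℝ) ^ ⌊-Real.logb m s⌋ ≠ 0 := zpow_ne_zero _ (by linarith)
  have hm1 : (m : ℝ) - 1 ≠ 0 := by linarith
  have : 1 + ((m : ℝ) - 1) * y = 1 / ((m : ℝ) ^ ⌊-Real.logb m s⌋ * s) := by
    rw [← hy]; field_simp; ring
  simp only [this]
  field_simp

/-- The recurrence for the distribution functions of successive images under the Chan map. -/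
theorem hasSum_measure_chanTau {m : ℕ} (hm : 2 ≤ m) (ν : Measure ℝ) [IsFiniteMeasure ν]
    [NullSingletonClass ν] (hν : ν (Icc (0 : ℝ) 1)ᶜ = 0) (hx : x ∈ Icc (0 : ℝ) 1) :
    HasSum (fun i => ν.real (Iic ((m : ℝ)⁻¹ ^ i)) - ν.real (Iic (branch m i x)))
      ((ν.map (chanTau m)).real (Iic x)) := by
  have hm' : (2 : ℝ) ≤ m := by exact_mod_cast hm
  have hm1 : (0 : ℝ) < m - 1 := by linarith
  have hD := one_le_den hm' hx
  have hDm := den_le hm' hx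
  have hle (i : ℕ) : branch m i x ≤ (m : ℝ)⁻¹ ^ i :=
    div_le_self (inv_pow_pos hm' i).le hD
  have hge (i : ℕ) : (m : ℝ)⁻¹ ^ (i + 1) ≤ branch m i x := by
    rw [branch, pow_succ, ← div_eq_mul_inv]
    exact div_le_div_of_nonneg_left (inv_pow_pos hm' i).le (by linarith) hDm
  have hanti : Antitone fun i : ℕ => (m : ℝ)⁻¹ ^ i :=
    pow_right_anti₀ (by positivity) (inv_lt_one hm').le
  have hiff (i : ℕ) (s : ℝ) (hs : s ∈ Ioc ((m : ℝ)⁻¹ ^ (i + 1)) ((m : ℝ)⁻¹ ^ i)) :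
      chanTau m s ≤ x ↔ branch m i x ≤ s := by
    have hs0 : 0 < s := (inv_pow_pos hm' _).trans hs.1
    rw [chanTau_of_mem hm hs, branch, div_le_iff₀ (by linarith), one_div_mul_eq_div,
      div_le_iff₀ hm1, sub_le_iff_le_add, div_le_iff₀ hs0, den]
    constructor <;> intro h <;> linarith
  have hdisj : Pairwise (Function.onFun Disjoint fun i : ℕ => Ioc (branch m i x) ((m : ℝ)⁻¹ ^ i)) :=
    fun i j hij => (hanti.pairwise_disjoint_on_Ioc_succ hij).mono
      (Ioc_subset_Ioc_left (hge i)) (Ioc_subset_Ioc_left (hge j))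
  have hae : chanTau m ⁻¹' Iic x =ᵐ[ν] ⋃ i : ℕ, Ioc (branch m i x) ((m : ℝ)⁻¹ ^ i) := by
    have h1 : ∀ᵐ s ∂ν, s ∈ Icc (0 : ℝ) 1 := hν
    have h2 : ∀ᵐ s ∂ν, s ∉ insert 0 (range fun i : ℕ => branch m i x) :=
      ((countable_range _).insert 0).ae_notMem ν
    filter_upwards [h1, h2] with s hs1 hs2
    have hne : ∀ i : ℕ, branch m i x ≠ s := fun i h => hs2 (Or.inr ⟨i, h⟩)
    have hs0 : 0 < s := hs1.1.lt_of_ne fun h => hs2 (Or.inl h.symm)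
    refine propext ?_
    change chanTau m s ≤ x ↔ s ∈ ⋃ i : ℕ, Ioc (branch m i x) ((m : ℝ)⁻¹ ^ i)
    rw [mem_iUnion]
    constructor
    · intro h
      obtain ⟨i, hi⟩ := exists_nat_pow_near_of_lt_one hs0 hs1.2 (by positivity) (inv_lt_one hm')
      exact ⟨i, ((hiff i s hi).1 h).lt_of_ne (hne i), hi.2⟩
    · rintro ⟨i, hi⟩
      exact (hiff i s ⟨(hge i).trans_lt hi.1, hi.2⟩).2 hi.1.le
  have hterm (i : ℕ) : ν.real (Iic ((m : ℝ)⁻¹ ^ i)) - ν.real (Iic (branch m i x)) =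
      ν.real (Ioc (branch m i x) ((m : ℝ)⁻¹ ^ i)) := by
    rw [← measureReal_sdiff (Iic_subset_Iic.2 (hle i)) measurableSet_Iic]
    congr 1
    ext s
    simp [and_comm]
  simp only [hterm]
  rw [measureReal_def, Measure.map_apply (measurable_chanTau m) measurableSet_Iic,
    measure_congr hae, measure_iUnion hdisj fun i => measurableSet_Ioc,
    ENNReal.tsum_toReal_eq fun i => measure_ne_top _ _]
  refine ENNReal.hasSum_toReal ?_
  rw [← measure_iUnion hdisj fun i => measurableSet_Ioc]
  exact measure_ne_top _ _

theorem chanTau_mem {m : ℕ} (hm : 2 ≤ m) {s : ℝ} (hs : s ∈ Icc (0 : ℝ) 1) :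
    chanTau m s ∈ Icc (0 : ℝ) 1 := by
  have hm' : (2 : ℝ) ≤ m := by exact_mod_cast hm
  have hm1 : (0 : ℝ) < m - 1 := by linarith
  rcases hs.1.eq_or_lt with rfl | hs0
  · simp [chanTau]
  obtain ⟨i, hi⟩ := exists_nat_pow_near_of_lt_one hs0 hs.2 (by positivity) (inv_lt_one hm')
  rw [chanTau_of_mem hm hi, one_div_mul_eq_div]
  have h1 : 1 ≤ (m : ℝ)⁻¹ ^ i / s := (one_le_div hs0).2 hi.2
  refine ⟨div_nonneg (by linarith) hm1.le, (div_le_one hm1).2 ?_⟩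
  rw [sub_le_sub_iff_right, div_le_iff₀ hs0]
  have h2 := mul_le_mul_of_nonneg_left hi.1.le (by positivity : (0 : ℝ) ≤ m)
  rwa [pow_succ, mul_comm, mul_assoc, inv_mul_cancel₀ (by positivity), mul_one] at h2

theorem derivBound_of_contDiffOn (b : ℝ) (hf : ContDiffOn ℝ 1 f (Icc (0 : ℝ) 1)) :
    ∃ K, DerivBound b K f := by
  have hc : ContinuousOn (fun x => den b x * |derivWithin f (Icc 0 1) x|) (Icc (0 : ℝ) 1) :=
    (HasDerivAt.continuousOn fun x _ => hasDerivAt_den b x).mul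
      (hf.continuousOn_derivWithin (uniqueDiffOn_Icc zero_lt_one) le_rfl).abs
  obtain ⟨K, hK⟩ := isCompact_Icc.exists_bound_of_continuousOn hc
  exact ⟨K, fun x hx => ⟨_, (hf.differentiableOn (by norm_num) x hx).hasDerivWithinAt,
    (le_abs_self _).trans (hK x hx)⟩⟩
end Chan

/-- if `μ` is a non-atomic Borel probability measure on `[0,1]` whose
distribution function `F_0(x) = μ([0,x])` is twice continuously differentiable on `[0,1]`,
and `F_n(x) = μ{t : τ_mⁿ(t) ≤ x}`,
`f_n(x) = (1+(m-1)x)(m+(m-1)x)·F_n′(x)`, then there are constants `q ∈ (0,1)` and `C > 0`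
with `|f_n′(x)| ≤ C·qⁿ` for all `n ∈ ℕ` and `x ∈ [0,1]`. -/
theorem chan_fn_deriv_decay (m : ℕ) (hm : 2 ≤ m)
    (μ : MeasureTheory.Measure ℝ) [MeasureTheory.IsProbabilityMeasure μ]
    (hsupp : μ (Set.Icc (0 : ℝ) 1)ᶜ = 0)
    (hatom : ∀ x : ℝ, μ {x} = 0)
    (F : ℕ → ℝ → ℝ)
    (hF : ∀ n : ℕ, ∀ x : ℝ,
      F n x = (μ {t | t ∈ Set.Icc (0 : ℝ) 1 ∧ (chanTau m)^[n] t ≤ x}).toReal)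
    (hsmooth : ContDiffOn ℝ 2 (F 0) (Set.Icc (0 : ℝ) 1)) :
    ∃ q ∈ Set.Ioo (0 : ℝ) 1, ∃ C > (0 : ℝ), ∀ n : ℕ,
      ∃ Fd fd : ℝ → ℝ,
        (∀ x ∈ Set.Icc (0 : ℝ) 1,
          HasDerivWithinAt (F n) (Fd x) (Set.Icc (0 : ℝ) 1) x) ∧
        (∀ x ∈ Set.Icc (0 : ℝ) 1,
          HasDerivWithinAt
            (fun y => (1 + ((m : ℝ) - 1) * y) * ((m : ℝ) + ((m : ℝ) - 1) * y) * Fd y)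
            (fd x) (Set.Icc (0 : ℝ) 1) x) ∧
        (∀ x ∈ Set.Icc (0 : ℝ) 1, |fd x| ≤ C * q ^ n) := by

  have hb : (2 : ℝ) ≤ m := by exact_mod_cast hm
  have hτ : ∀ n, Measurable (chanTau m)^[n] := fun n => (Chan.measurable_chanTau m).iterate n
  have hFreal : ∀ n x, F n x = (μ.map (chanTau m)^[n]).real (Iic x) := by
    intro n x
    rw [hF, measureReal_def, Measure.map_apply (hτ n) measurableSet_Iic]
    congr 1
    refine measure_congr ?_
    have h1 : ∀ᵐ s ∂μ, s ∈ Icc (0 : ℝ) 1 := hsupp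
    filter_upwards [h1] with s hs
    exact propext ⟨fun h => h.2, fun h => ⟨hs, h⟩⟩
  have hmap : ∀ n, μ.map (chanTau m)^[n + 1] = (μ.map (chanTau m)^[n]).map (chanTau m) := by
    intro n
    rw [Measure.map_map (Chan.measurable_chanTau m) (hτ n), Function.iterate_succ']
  have hatoms : ∀ n, NullSingletonClass (μ.map (chanTau m)^[n]) := by
    intro n
    induction n with
    | zero => exact ⟨fun x => by simpa using hatom x⟩
    | succ n ih =>
      refine ⟨fun x => ?_⟩
      rw [hmap, Measure.map_apply (Chan.measurable_chanTau m) (measurableSet_singleton x)]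
      exact (Chan.countable_preimage_chanTau hm x).measure_zero _
  have hconc : ∀ n, (μ.map (chanTau m)^[n]) (Icc (0 : ℝ) 1)ᶜ = 0 := by
    intro n
    rw [Measure.map_apply (hτ n) measurableSet_Icc.compl]
    refine measure_mono_null (t := (Icc (0 : ℝ) 1)ᶜ) (fun s hs hs' => hs ?_) hsupp
    exact MapsTo.iterate (fun _ h => Chan.chanTau_mem hm h) n hs'
  set f₀ : ℝ → ℝ := fun y => (1 + ((m : ℝ) - 1) * y) * ((m : ℝ) + ((m : ℝ) - 1) * y) *
    derivWithin (F 0) (Icc 0 1) y with hf₀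
  have hf₀s : ContDiffOn ℝ 1 f₀ (Icc (0 : ℝ) 1) := by
    have h : ContDiffOn ℝ 1 (derivWithin (F 0) (Icc 0 1)) (Icc (0 : ℝ) 1) :=
      hsmooth.derivWithin (uniqueDiffOn_Icc zero_lt_one) (by norm_num)
    have h' : ContDiff ℝ 1 fun y : ℝ =>
        (1 + ((m : ℝ) - 1) * y) * ((m : ℝ) + ((m : ℝ) - 1) * y) := by fun_prop
    exact h'.contDiffOn.mul h
  obtain ⟨K, hK⟩ := Chan.derivBound_of_contDiffOn m hf₀s
  obtain ⟨O, hO⟩ := isCompact_Icc.exists_bound_of_continuousOn hf₀s.continuousOn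
  have hne : ∀ x ∈ Icc (0 : ℝ) 1, Chan.den m x * ((m : ℝ) + ((m : ℝ) - 1) * x) ≠ 0 := by
    intro x hx
    have h1 := Chan.one_le_den hb hx
    have h2 := mul_nonneg (by linarith : (0 : ℝ) ≤ m - 1) hx.1
    exact mul_ne_zero (by linarith) (by linarith)
  have hderiv : ∀ n, ∀ x ∈ Icc (0 : ℝ) 1, HasDerivWithinAt (F n)
      (1 / (Chan.den m x * ((m : ℝ) + ((m : ℝ) - 1) * x)) * (Chan.transfer m)^[n] f₀ x)
      (Icc 0 1) x := by
    intro n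
    induction n with
    | zero =>
      intro x hx
      refine (hsmooth.differentiableOn (by norm_num) x hx).hasDerivWithinAt.congr_deriv ?_
      have h := hne x hx
      rw [Function.iterate_zero, id, hf₀, one_div]
      exact (inv_mul_cancel_left₀ h _).symm
    | succ n ih =>
      rw [Function.iterate_succ_apply']
      refine Chan.hasDerivWithinAt_of_hasSum hb ih (Chan.abs_iterate_transfer_le hb hO n) ?_
      intro x hx
      have := hatoms n
      have := Measure.isProbabilityMeasure_map (μ := μ) (hτ n).aemeasurable
      have h := Chan.hasSum_measure_chanTau hm _ (hconc n) hx
      rw [← hmap] at h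
      simpa only [hFreal] using h
  obtain ⟨q, hq, C, hC, hdecay⟩ := hK.exists_decay hb
  refine ⟨q, hq, C, hC, fun n => ?_⟩
  choose! fd hfd hfdle using hdecay n
  refine ⟨_, fd, hderiv n, fun x hx => (hfd x hx).congr_of_mem (fun y hy => ?_) hx, fun x hx => ?_⟩
  · rw [one_div]
    exact mul_inv_cancel_left₀ (hne y hy) _
  · exact (le_mul_of_one_le_left (abs_nonneg _) (Chan.one_le_den hb hx)).trans (hfdle x hx)
end
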